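/- arXiv:1909.10417 — 9 statements merged into one kernel-verified Lean document; each statement's English description precedes it below -/
import Mathlib

section
/- The quotient map q : ℓ∞ → ℓ∞/c₀ does not admit a uniformly continuous right inverse; that is, there is no uniformly continuous map τ : ℓ∞/c₀ → ℓ∞ with q ∘ τ equal to the identity on ℓ∞/c₀. -/
open ENNReal Filter

/-- `c₀`: the closed subspace of `ℓ∞` of sequences converging to `0`. -/
noncomputable def czero : Submodule ℝ (lp (fun _ : ℕ => ℝ) ∞) where
  carrier := {f | Tendsto (fun n => f n) atTop (nhds 0)}
  add_mem' := by
    intro f g hf hg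
    have := hf.add hg
    simpa [lp.coeFn_add, Pi.add_apply] using this
  zero_mem' := by
    simpa [lp.coeFn_zero] using tendsto_const_nhds (α := ℝ) (f := atTop (α := ℕ))
  smul_mem' := by
    intro c f hf
    have := hf.const_mul c
    simpa [lp.coeFn_smul, Pi.smul_apply, smul_eq_mul] using this

/-- Eventual strict domination of functions `ℕ → ℕ`. -/
def EventuallyDominated (p q : ℕ → ℕ) : Prop := ∀ᶠ m in atTop, p m < q m

theorem exists_eventuallyDominated (b : ℕ → ℕ) (s : ℕ → ℕ → ℕ) :
    ∃ q, EventuallyDominated b q ∧ ∀ i, EventuallyDominated (s i) q := by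
  refine ⟨fun m => b m + ∑ i ∈ Finset.range (m + 1), s i m + 1, .of_forall fun m => by
    dsimp only; omega, fun i => ?_⟩
  filter_upwards [eventually_ge_atTop i] with m hm
  have := Finset.single_le_sum (f := fun i => s i m) (fun _ _ => Nat.zero_le _)
    (Finset.mem_range.2 (show i < m + 1 by omega))
  omega

/-- The indicator of the region below the graph of `p`, transported from `ℕ × ℕ` to `ℕ`,
as an element of `ℓ∞`. -/
noncomputable def subgraphIndicator (p : ℕ → ℕ) : lp (fun _ : ℕ => ℝ) ∞ :=
  ⟨fun k => if k.unpair.2 ≤ p k.unpair.1 then 1 else 0, memℓp_infty ⟨1, by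
    rintro _ ⟨k, rfl⟩
    dsimp only
    split_ifs <;> simp⟩⟩

theorem subgraphIndicator_apply (p : ℕ → ℕ) (k : ℕ) :
    subgraphIndicator p k = if k.unpair.2 ≤ p k.unpair.1 then 1 else 0 := rfl

theorem subgraphIndicator_nonneg (p : ℕ → ℕ) (k : ℕ) : 0 ≤ subgraphIndicator p k := by
  rw [subgraphIndicator_apply]
  split_ifs <;> simp

theorem subgraphIndicator_le_one (p : ℕ → ℕ) (k : ℕ) : subgraphIndicator p k ≤ 1 := by
  rw [subgraphIndicator_apply]
  split_ifs <;> simp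

theorem EventuallyDominated.subgraphIndicator_le {p q : ℕ → ℕ} (h : EventuallyDominated p q) :
    ∀ᶠ k in atTop, subgraphIndicator p k ≤ subgraphIndicator q k := by
  obtain ⟨N, hN⟩ := eventually_atTop.1 h
  rw [← Nat.cofinite_eq_atTop]
  have hfin : (⋃ m ∈ Set.Iio N, (Nat.pair m) '' Set.Iic (p m)).Finite :=
    (Set.finite_Iio N).biUnion fun m _ => (Set.finite_Iic _).image _
  filter_upwards [hfin.compl_mem_cofinite] with k hk
  rw [subgraphIndicator_apply, subgraphIndicator_apply]
  by_cases hp : k.unpair.2 ≤ p k.unpair.1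
  · have hNk : N ≤ k.unpair.1 := by
      by_contra! hlt
      exact hk (Set.mem_biUnion (Set.mem_Iio.2 hlt) ⟨_, hp, Nat.pair_unpair k⟩)
    rw [if_pos hp, if_pos (hp.trans (hN _ hNk).le)]
  · rw [if_neg hp]
    split_ifs <;> simp

theorem EventuallyDominated.frequently_subgraphIndicator {p q : ℕ → ℕ}
    (h : EventuallyDominated p q) :
    ∃ᶠ k in atTop, subgraphIndicator p k = 0 ∧ subgraphIndicator q k = 1 := by
  obtain ⟨N, hN⟩ := eventually_atTop.1 h
  refine frequently_atTop.2 fun K => ?_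
  refine ⟨Nat.pair (max N K) (q (max N K)),
    (le_max_right N K).trans (Nat.left_le_pair _ _), ?_⟩
  have := hN (max N K) (le_max_left _ _)
  simp [subgraphIndicator_apply, this]

/-- Modulo finitely many coordinates, `0 ≤ z - y ≤ 1` with `z - y` supported below the graph
of `b`. -/
def SubgraphClose (y z : lp (fun _ : ℕ => ℝ) ∞) (b : ℕ → ℕ) : Prop :=
  ∀ᶠ k in atTop, y k ≤ z k ∧ z k ≤ y k + subgraphIndicator b k

theorem SubgraphClose.add_right {y z : lp (fun _ : ℕ => ℝ) ∞} {b : ℕ → ℕ}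
    (h : SubgraphClose y z b) (v : lp (fun _ : ℕ => ℝ) ∞) :
    SubgraphClose (y + v) (z + v) b := by
  filter_upwards [h] with k hk
  simp only [lp.coeFn_add, Pi.add_apply]
  constructor <;> linarith

theorem subgraphClose_self_add (y : lp (fun _ : ℕ => ℝ) ∞) (p : ℕ → ℕ) :
    SubgraphClose y (y + subgraphIndicator p) p := by
  refine .of_forall fun k => ?_
  have := subgraphIndicator_nonneg p k
  simp only [lp.coeFn_add, Pi.add_apply]
  constructor <;> linarith

theorem SubgraphClose.add_of_dominated {y z : lp (fun _ : ℕ => ℝ) ∞} {b a c d : ℕ → ℕ}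
    (h : SubgraphClose y z b) (hba : EventuallyDominated b a) (hac : EventuallyDominated a c)
    (hcd : EventuallyDominated c d) :
    SubgraphClose (y + subgraphIndicator a) (z + subgraphIndicator c) d := by
  filter_upwards [h, hba.subgraphIndicator_le, hac.subgraphIndicator_le,
    hcd.subgraphIndicator_le] with k h1 h2 h3 h4
  simp only [lp.coeFn_add, Pi.add_apply]
  constructor <;> linarith

/-- `φ` varies by at most one between points that are close in the sense of `SubgraphClose`. -/
def SubgraphStable (φ : lp (fun _ : ℕ => ℝ) ∞ → ℤ) : Prop :=
  ∀ y z b, SubgraphClose y z b → |φ y - φ z| ≤ 1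

/-- The upper limit of `φ (x + subgraphIndicator q)` along eventual domination in `q`. -/
theorem SubgraphStable.exists_upper_limit {φ : lp (fun _ : ℕ => ℝ) ∞ → ℤ}
    (hφ : SubgraphStable φ) :
    ∃ ψ : lp (fun _ : ℕ => ℝ) ∞ → ℤ, SubgraphStable ψ ∧
      (∀ x, ∃ p, ∀ q, EventuallyDominated p q → φ (x + subgraphIndicator q) ≤ ψ x) ∧
      ∀ x p, ∃ q, EventuallyDominated p q ∧ ψ x ≤ φ (x + subgraphIndicator q) := by
  have key : ∀ x, ∃ c : ℤ,
      (∃ p, ∀ q, EventuallyDominated p q → φ (x + subgraphIndicator q) ≤ c) ∧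
      ∀ p, ∃ q, EventuallyDominated p q ∧ c ≤ φ (x + subgraphIndicator q) := by
    intro x
    have hb : ∀ q, |φ x - φ (x + subgraphIndicator q)| ≤ 1 := fun q =>
      hφ _ _ q (subgraphClose_self_add x q)
    obtain ⟨c, hc, hmax⟩ := Int.exists_greatest_of_bdd
      (P := fun c => ∀ p, ∃ q, EventuallyDominated p q ∧ c ≤ φ (x + subgraphIndicator q))
      ⟨φ x + 1, fun c hc => by
        obtain ⟨q, -, hq⟩ := hc 0
        have := abs_le.1 (hb q)
        linarith⟩
      ⟨φ x - 1, fun p => by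
        obtain ⟨q, hq, -⟩ := exists_eventuallyDominated p fun _ => p
        have := abs_le.1 (hb q)
        exact ⟨q, hq, by linarith⟩⟩
    refine ⟨c, ?_, hc⟩
    by_contra! hcon
    have := hmax (c + 1) fun p => by
      obtain ⟨q, hq, hlt⟩ := hcon p
      exact ⟨q, hq, hlt⟩
    omega
  choose ψ hev hfr using key
  refine ⟨ψ, ?_, hev, hfr⟩
  have hle : ∀ x y, (∀ v, |φ (x + v) - φ (y + v)| ≤ 1) → ψ x ≤ ψ y + 1 := by
    intro x y hxy
    obtain ⟨p, hp⟩ := hev y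
    obtain ⟨q, hq, hle⟩ := hfr x p
    have h1 := hp q hq
    have h2 := abs_le.1 (hxy (subgraphIndicator q))
    linarith
  intro y z b h
  have h1 := hle y z fun v => hφ _ _ b (h.add_right v)
  have h2 := hle z y fun v => by
    rw [abs_sub_comm]
    exact hφ _ _ b (h.add_right v)
  rw [abs_le]
  constructor <;> linarith

/-- For a sequence of stable functions, `n` nested upper limits are simultaneously almost attained
along sums of `n` subgraph indicators. -/
theorem exists_iterated_upper_limit (n : ℕ) (φ : ℕ → lp (fun _ : ℕ => ℝ) ∞ → ℤ)
    (hφ : ∀ i, SubgraphStable (φ i)) :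
    ∃ M : ℕ → lp (fun _ : ℕ => ℝ) ∞ → ℤ, ∀ y (z : ℕ → lp (fun _ : ℕ => ℝ) ∞) b,
      (∀ i, SubgraphClose y (z i) b) →
      ∃ (y' : lp (fun _ : ℕ => ℝ) ∞) (z' : ℕ → lp (fun _ : ℕ => ℝ) ∞) (b' : ℕ → ℕ),
        (∀ i, SubgraphClose y' (z' i) b') ∧
        (∀ i, φ i y' ≤ M i y) ∧ (∀ i, M i (z i) ≤ φ i (z' i)) ∧
        ∀ᶠ k in atTop, subgraphIndicator b k ≤ subgraphIndicator b' k ∧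
          y k + n * subgraphIndicator b k ≤ y' k ∧
          y' k ≤ y k + n * subgraphIndicator b' k := by
  induction n generalizing φ with
  | zero =>
    exact ⟨φ, fun y z b h => ⟨y, z, b, h, fun _ => le_rfl, fun _ => le_rfl, by simp⟩⟩
  | succ n ih =>
    choose ψ hψ hev hfr using fun i => (hφ i).exists_upper_limit
    obtain ⟨M, hM⟩ := ih ψ hψ
    refine ⟨M, fun y z b h => ?_⟩
    obtain ⟨y₁, z₁, b₁, hclose, hy, hz, hk⟩ := hM y z b h
    choose p hp using fun i => hev i y₁
    obtain ⟨a, hba, hpa⟩ := exists_eventuallyDominated b₁ p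
    choose c hac hc using fun i => hfr i (z₁ i) a
    obtain ⟨d, had, hcd⟩ := exists_eventuallyDominated a c
    refine ⟨y₁ + subgraphIndicator a, fun i => z₁ i + subgraphIndicator (c i), d,
      fun i => (hclose i).add_of_dominated hba (hac i) (hcd i),
      fun i => (hp i a (hpa i)).trans (hy i), fun i => (hz i).trans (hc i), ?_⟩
    filter_upwards [hk, hba.subgraphIndicator_le, had.subgraphIndicator_le]
      with k ⟨h1, h2, h3⟩ h4 h5
    have h6 : (n : ℝ) * subgraphIndicator b₁ k ≤ n * subgraphIndicator d k :=
      mul_le_mul_of_nonneg_left (h4.trans h5) n.cast_nonneg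
    simp only [lp.coeFn_add, Pi.add_apply]
    push_cast
    refine ⟨?_, ?_, ?_⟩ <;> linarith

theorem norm_mkQ_czero_le {v : lp (fun _ : ℕ => ℝ) ∞} {C : ℝ} (hC : 0 ≤ C)
    (h : ∀ᶠ k in atTop, |v k| ≤ C) : ‖czero.mkQ v‖ ≤ C := by
  have hbound : ∀ k, ‖max (-C) (min C (v k))‖ ≤ C := fun k => by
    rw [Real.norm_eq_abs, abs_le]
    exact ⟨le_max_left _ _, max_le (by linarith) (min_le_left _ _)⟩
  let w : lp (fun _ : ℕ => ℝ) ∞ := ⟨fun k => max (-C) (min C (v k)), memℓp_infty ⟨C, by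
    rintro _ ⟨k, rfl⟩
    exact hbound k⟩⟩
  have hw : ‖w‖ ≤ C := lp.norm_le_of_forall_le hC hbound
  have hvw : czero.mkQ v = czero.mkQ w := by
    refine (Submodule.Quotient.eq czero).2 ?_
    refine tendsto_const_nhds.congr' ?_
    filter_upwards [h] with k hk
    rw [abs_le] at hk
    change 0 = v k - max (-C) (min C (v k))
    rw [min_eq_right hk.2, max_eq_right hk.1, sub_self]
  rw [hvw]
  exact (Submodule.Quotient.norm_mk_le czero w).trans hw

/-- The quotient map `q : ℓ∞ → ℓ∞/c₀` does not admit a uniformly continuous right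
inverse: there is no uniformly continuous `τ : ℓ∞/c₀ → ℓ∞` with `q ∘ τ = id`. -/
theorem quotient_map_ellInfty_czero_no_uniformly_continuous_right_inverse :
    ¬ ∃ τ : ((lp (fun _ : ℕ => ℝ) ∞) ⧸ czero) → lp (fun _ : ℕ => ℝ) ∞,
      UniformContinuous τ ∧ ∀ x, czero.mkQ (τ x) = x := by
  rintro ⟨τ, hτ, hq⟩
  obtain ⟨δ, hδ, hτδ⟩ := Metric.uniformContinuous_iff.1 hτ 1 one_pos
  set c := δ / 2
  have hc0 : 0 < c := half_pos hδ
  let σ : lp (fun _ : ℕ => ℝ) ∞ → lp (fun _ : ℕ => ℝ) ∞ := fun v => τ (czero.mkQ (c • v))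
  have hstable : ∀ i, SubgraphStable fun v => ⌊σ v i⌋ := by
    intro i y z b h
    have hdist : dist (czero.mkQ (c • y)) (czero.mkQ (c • z)) < δ := by
      rw [dist_eq_norm, ← map_sub, ← smul_sub]
      refine (norm_mkQ_czero_le hc0.le ?_).trans_lt (half_lt_self hδ)
      filter_upwards [h] with k hk
      have h1 := subgraphIndicator_le_one b k
      change |c * (y k - z k)| ≤ c
      rw [abs_mul, abs_of_pos hc0]
      exact mul_le_of_le_one_right hc0.le (abs_le.2 ⟨by linarith, by linarith⟩)
    have h1 : |σ y i - σ z i| < 1 := by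
      have h2 := hτδ hdist
      rw [dist_eq_norm] at h2
      exact (lp.norm_apply_le_norm ENNReal.top_ne_zero (σ y - σ z) i).trans_lt h2
    have h2 := abs_lt.1 h1
    have h3 : ⌊σ y i⌋ < ⌊σ z i⌋ + 2 := by
      rw [Int.floor_lt]
      push_cast
      linarith [Int.lt_floor_add_one (σ z i)]
    have h4 : ⌊σ z i⌋ < ⌊σ y i⌋ + 2 := by
      rw [Int.floor_lt]
      push_cast
      linarith [Int.lt_floor_add_one (σ y i)]
    rw [abs_le]
    constructor <;> dsimp only <;> omega
  obtain ⟨n, hn⟩ := exists_nat_gt (3 / c)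
  rw [div_lt_iff₀ hc0] at hn
  obtain ⟨M, hM⟩ := exists_iterated_upper_limit n _ hstable
  have hzero : ∀ b, ∀ _ : ℕ, SubgraphClose 0 0 b := fun b _ => .of_forall fun k => by
    simpa using subgraphIndicator_nonneg b k
  have hval : ∀ b, ∃ y b', (∀ i, (M i 0 : ℝ) - 1 ≤ σ y i ∧ σ y i < M i 0 + 1) ∧
      ∀ᶠ k in atTop, n * subgraphIndicator b k ≤ y k ∧ y k ≤ n * subgraphIndicator b' k := by
    intro b
    obtain ⟨y, z, b', hclose, hy, hz, hk⟩ := hM 0 (fun _ => 0) b (hzero b)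
    refine ⟨y, b', fun i => ?_, ?_⟩
    · have h1 := abs_le.1 (hstable i y (z i) b' (hclose i))
      have h2 : (M i 0 : ℤ) - 1 ≤ ⌊σ y i⌋ := by
        have := hz i
        dsimp only at h1 this
        linarith
      have h3 : ⌊σ y i⌋ < M i 0 + 1 := Int.lt_add_one_of_le (hy i)
      rw [Int.le_floor] at h2
      rw [Int.floor_lt] at h3
      push_cast at h2 h3
      exact ⟨h2, h3⟩
    · filter_upwards [hk] with k hk
      simpa using hk.2
  obtain ⟨y, b, hy, hyb⟩ := hval 0
  obtain ⟨d, hbd, -⟩ := exists_eventuallyDominated b fun _ => b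
  obtain ⟨x, _, hx, hxd⟩ := hval d
  have hmem : (σ x - σ y) - c • (x - y) ∈ czero := by
    rw [← Submodule.ker_mkQ czero, LinearMap.mem_ker]
    simp only [map_sub, σ, hq, smul_sub, sub_self]
  have hlim : ∀ᶠ k in atTop, |σ x k - σ y k - c * (x k - y k)| < 1 := by
    have := Metric.tendsto_nhds.1 (show Tendsto _ _ _ from hmem) 1 one_pos
    filter_upwards [this] with k hk
    rw [dist_zero_right] at hk
    exact hk
  obtain ⟨k, ⟨hb, hd⟩, hk, hyk, hxk⟩ :=
    (hbd.frequently_subgraphIndicator.and_eventually (hlim.and (hyb.and hxd))).exists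
  rw [hb] at hyk
  rw [hd] at hxk
  have h1 := abs_lt.1 hk
  have h2 : c * n ≤ c * (x k - y k) :=
    mul_le_mul_of_nonneg_left (by linarith [hyk.2, hxk.1]) hc0.le
  linarith [(hx k).2, (hy k).1]
end

section
/- Let 𝐢 and 𝐣 be ideals in ℕ with 𝐢 ⋐ 𝐣. Then there exists an uncountable collection {𝐤_i}_{i∈I} of ideals in ℕ such that 𝐢 ⋐ 𝐤_i ⋐ 𝐣 for every i ∈ I, and for any two distinct i₀, i₁ ∈ I the ideals 𝐤_{i₀} and 𝐤_{i₁} are incomparable with respect to ⋐ (neither 𝐤_{i₀} ⋐ 𝐤_{i₁} nor 𝐤_{i₁} ⋐ 𝐤_{i₀} holds). -/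
/-- An ideal in `ℕ`: closed under unions and subsets. -/
def IsIdealN (i : Set (Set ℕ)) : Prop :=
  (∀ A B : Set ℕ, A ∈ i → B ∈ i → A ∪ B ∈ i) ∧
  (∀ A B : Set ℕ, A ∈ i → B ⊆ A → B ∈ i)

/-- `𝐢 ⋐ 𝐣`: `𝐣` is much larger than `𝐢`, i.e. `𝐢 ⊊ 𝐣` and there is a countable
collection `{D_j}` of nonempty pairwise disjoint members of `𝐢` such that for every
infinite `K ⊆ ℕ` the union `⋃_{k∈K} D_k` lies in `𝐣 \ 𝐢`. -/
def MuchLarger (i j : Set (Set ℕ)) : Prop :=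
  i ⊂ j ∧ ∃ D : ℕ → Set ℕ,
    (∀ n, D n ∈ i) ∧ (∀ n, (D n).Nonempty) ∧
    (∀ m n, m ≠ n → Disjoint (D m) (D n)) ∧
    (∀ K : Set ℕ, K.Infinite → (⋃ k ∈ K, D k) ∈ j ∧ (⋃ k ∈ K, D k) ∉ i)

/-- The ideal generated by an ideal `i` together with one further set `U`. -/
def adjoinSet (i : Set (Set ℕ)) (U : Set ℕ) : Set (Set ℕ) :=
  {B | ∃ I ∈ i, B ⊆ I ∪ U}

theorem IsIdealN.adjoinSet {i : Set (Set ℕ)} (hi : IsIdealN i) (U : Set ℕ) :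
    IsIdealN (adjoinSet i U) := by
  refine ⟨?_, fun A B ⟨I, hI, hA⟩ hBA => ⟨I, hI, hBA.trans hA⟩⟩
  rintro A B ⟨I, hI, hA⟩ ⟨J, hJ, hB⟩
  refine ⟨I ∪ J, hi.1 I J hI hJ, ?_⟩
  rw [Set.union_union_distrib_right]
  exact Set.union_subset_union hA hB

theorem subset_adjoinSet (i : Set (Set ℕ)) (U : Set ℕ) : i ⊆ adjoinSet i U :=
  fun I hI => ⟨I, hI, Set.subset_union_left⟩

theorem adjoinSet_subset {i j : Set (Set ℕ)} (hj : IsIdealN j) (hij : i ⊆ j) {U : Set ℕ}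
    (hU : U ∈ j) : adjoinSet i U ⊆ j :=
  fun B ⟨I, hI, hB⟩ => hj.2 _ B (hj.1 I U (hij hI) hU) hB

/-- A union of infinitely many `D k` with indices outside `A` is not covered, modulo `i`,
by the union of the `D k` with indices in `A`. -/
theorem biUnion_notMem_adjoinSet {i : Set (Set ℕ)} (hi : IsIdealN i) {D : ℕ → Set ℕ}
    (hdisj : ∀ m n, m ≠ n → Disjoint (D m) (D n))
    (hD : ∀ K : Set ℕ, K.Infinite → (⋃ k ∈ K, D k) ∉ i) {A K : Set ℕ}
    (hK : (K \ A).Infinite) : (⋃ k ∈ K, D k) ∉ adjoinSet i (⋃ k ∈ A, D k) := by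
  rintro ⟨I, hI, hsub⟩
  refine hD _ hK (hi.2 I _ hI ?_)
  intro x hx
  simp only [Set.mem_iUnion, exists_prop] at hx
  obtain ⟨k, ⟨hkK, hkA⟩, hxk⟩ := hx
  refine (hsub (Set.mem_biUnion hkK hxk)).resolve_right fun hx => ?_
  simp only [Set.mem_iUnion, exists_prop] at hx
  obtain ⟨l, hlA, hxl⟩ := hx
  exact (hdisj k l fun h => hkA (h ▸ hlA)).notMem_of_mem_left hxk hxl

/-- To show `i ⋐ j` it suffices to have a suitable disjoint family indexed by an infinite
subset of `ℕ`. -/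
theorem MuchLarger.of_infinite {i j : Set (Set ℕ)} (hij : i ⊆ j) {D : ℕ → Set ℕ} {S : Set ℕ}
    (hS : S.Infinite) (hmem : ∀ n, D n ∈ i) (hne : ∀ n, (D n).Nonempty)
    (hdisj : ∀ m n, m ≠ n → Disjoint (D m) (D n))
    (hD : ∀ K ⊆ S, K.Infinite → (⋃ k ∈ K, D k) ∈ j ∧ (⋃ k ∈ K, D k) ∉ i) :
    MuchLarger i j := by
  refine ⟨⟨hij, fun hji => (hD S subset_rfl hS).2 (hji (hD S subset_rfl hS).1)⟩, ?_⟩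
  let e := hS.natEmbedding
  have he : Function.Injective fun n => (e n : ℕ) := Subtype.val_injective.comp e.injective
  refine ⟨fun n => D (e n), fun n => hmem _, fun n => hne _,
    fun m n hmn => hdisj _ _ (he.ne hmn), fun K hK => ?_⟩
  rw [← Set.biUnion_image (f := fun n => (e n : ℕ)) (g := D)]
  refine hD _ ?_ (hK.image he.injOn)
  rintro _ ⟨n, -, rfl⟩
  exact (e n).2

/-- The set of codes of the finite initial segments of a binary sequence. -/
def segmentCodes (f : ℕ → Bool) : Set ℕ :=
  Set.range fun n => Encodable.encode ((List.range n).map f)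

theorem infinite_segmentCodes_diff {f g : ℕ → Bool} (hfg : f ≠ g) :
    (segmentCodes f \ segmentCodes g).Infinite := by
  obtain ⟨m, hm⟩ := Function.ne_iff.mp hfg
  have hinj : Function.Injective fun n => Encodable.encode ((List.range n).map f) := by
    intro a b hab
    simpa using congrArg List.length (Encodable.encode_injective hab)
  refine ((Set.Ioi_infinite m).image hinj.injOn).mono ?_
  rintro _ ⟨n, hn, rfl⟩
  refine ⟨⟨n, rfl⟩, ?_⟩
  rintro ⟨l, hl⟩
  have hl := Encodable.encode_injective hl
  obtain rfl : l = n := by simpa using congrArg List.length hl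
  exact hm (List.map_inj_left.mp hl m (List.mem_range.mpr hn)).symm

theorem infinite_compl_segmentCodes (f : ℕ → Bool) : (segmentCodes f)ᶜ.Infinite :=
  (infinite_segmentCodes_diff (f := fun n => !f n) (g := f)
    fun h => by simpa using congrFun h 0).mono fun _ h => h.2

theorem infinite_segmentCodes (f : ℕ → Bool) : (segmentCodes f).Infinite :=
  (infinite_segmentCodes_diff (f := f) (g := fun n => !f n)
    fun h => by simpa using congrFun h 0).mono Set.sdiff_subset

/-- Between any two ideals `𝐢 ⋐ 𝐣` there is an uncountable collection of ideals,
each strictly between `𝐢` and `𝐣` for `⋐`, and pairwise `⋐`-incomparable. -/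
theorem exists_uncountable_pairwise_incomparable_ideals_between
    (i j : Set (Set ℕ)) (hi : IsIdealN i) (hj : IsIdealN j) (h : MuchLarger i j) :
    ∃ ks : Set (Set (Set ℕ)), ¬ ks.Countable ∧
      (∀ k ∈ ks, IsIdealN k ∧ MuchLarger i k ∧ MuchLarger k j) ∧
      (∀ k₀ ∈ ks, ∀ k₁ ∈ ks, k₀ ≠ k₁ → ¬ MuchLarger k₀ k₁ ∧ ¬ MuchLarger k₁ k₀) := by
  obtain ⟨⟨hij, -⟩, D, hmem, hne, hdisj, hD⟩ := h
  let k (f : ℕ → Bool) : Set (Set ℕ) := adjoinSet i (⋃ n ∈ segmentCodes f, D n)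
  have hk (f : ℕ → Bool) : (⋃ n ∈ segmentCodes f, D n) ∈ k f :=
    ⟨D 0, hmem 0, Set.subset_union_right⟩
  have hnot {f g : ℕ → Bool} (hfg : f ≠ g) : ¬ k f ⊆ k g := fun hsub =>
    biUnion_notMem_adjoinSet hi hdisj (fun K hK => (hD K hK).2)
      (infinite_segmentCodes_diff hfg) (hsub (hk f))
  have hinj : Function.Injective k := fun f g hfg =>
    by_contra fun hne => hnot hne hfg.subset
  refine ⟨Set.range k, fun hc => ?_, ?_, ?_⟩
  · have : Countable (ℕ → Bool) :=
      Set.countable_univ_iff.mp (Set.countable_of_injective_of_countable_image hinj.injOn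
        (Set.image_univ ▸ hc))
    obtain ⟨e, he⟩ := exists_surjective_nat (ℕ → Bool)
    obtain ⟨n, hn⟩ := he fun n => !e n n
    simpa using congrFun hn n
  · rintro _ ⟨f, rfl⟩
    refine ⟨hi.adjoinSet _, ?_, ?_⟩
    · refine .of_infinite (subset_adjoinSet _ _) (infinite_segmentCodes f) hmem hne hdisj
        fun K hKf hK => ⟨?_, (hD K hK).2⟩
      exact (hi.adjoinSet _).2 _ _ (hk f) (Set.biUnion_subset_biUnion_left hKf)
    · refine .of_infinite (adjoinSet_subset hj hij (hD _ (infinite_segmentCodes f)).1)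
        (infinite_compl_segmentCodes f) (fun n => subset_adjoinSet _ _ (hmem n)) hne hdisj
        fun K hKf hK => ⟨(hD K hK).1, ?_⟩
      refine biUnion_notMem_adjoinSet hi hdisj (fun K hK => (hD K hK).2) ?_
      rwa [(Set.disjoint_left.mpr hKf).sdiff_eq_left]
  · rintro _ ⟨f, rfl⟩ _ ⟨g, rfl⟩ hfg
    have hfg : f ≠ g := fun h => hfg (congrArg k h)
    exact ⟨fun h => hnot hfg h.1.1, fun h => hnot hfg.symm h.1.1⟩
end

section
/- Let 𝐢 and 𝐣 be ideals in ℕ with 𝐢 ⋐ 𝐣. Then there exists a maximal ⋐-chain of ideals in ℕ having 𝐢 as least element and 𝐣 as greatest element (maximal with respect to set inclusion among such chains), and every such maximal ⋐-chain is uncountable. -/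
/-- A `⋐`-chain of ideals in `ℕ` with least element `𝐢` and greatest element `𝐣`. -/
def IsMuchLargerChainLG (i j : Set (Set ℕ)) (C : Set (Set (Set ℕ))) : Prop :=
  (∀ k ∈ C, IsIdealN k) ∧ IsChain MuchLarger C ∧ i ∈ C ∧ j ∈ C ∧
    ∀ k ∈ C, k ≠ i → k ≠ j → MuchLarger i k ∧ MuchLarger k j

/-- Given countably many properties of sets of naturals, there is a strictly increasing sequence
which for each of the properties eventually stays in a set that either has the property or has no
infinite subset with it. -/
theorem exists_strictMono_decides (p : ℕ → Set ℕ → Prop) :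
    ∃ x : ℕ → ℕ, StrictMono x ∧ ∀ n,
      (∃ T : Set ℕ, (∀ r, n ≤ r → x r ∈ T) ∧
        ((∀ S ⊆ T, S.Infinite → ¬ p n S) ∨ p n T)) := by
  have step : ∀ (n : ℕ) (T : {T : Set ℕ // T.Infinite}), ∃ T' : {T : Set ℕ // T.Infinite},
      T'.1 ⊆ T.1 ∧ ((∀ S ⊆ T'.1, S.Infinite → ¬ p n S) ∨ p n T'.1) := by
    rintro n ⟨T, hT⟩
    by_cases h : ∃ S ⊆ T, S.Infinite ∧ p n S
    · obtain ⟨S, hST, hS, hp⟩ := h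
      exact ⟨⟨S, hS⟩, hST, Or.inr hp⟩
    · exact ⟨⟨T, hT⟩, subset_rfl, Or.inl fun S hST hS hp => h ⟨S, hST, hS, hp⟩⟩
  choose g hg hdec using step
  let T : ℕ → {T : Set ℕ // T.Infinite} :=
    fun n => Nat.rec (g 0 ⟨Set.univ, Set.infinite_univ⟩) (fun r T => g (r + 1) T) n
  have hT : Antitone fun n => (T n).1 := antitone_nat_of_succ_le fun n => hg (n + 1) (T n)
  have hTdec : ∀ n, (∀ S ⊆ (T n).1, S.Infinite → ¬ p n S) ∨ p n (T n).1 := by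
    rintro (_ | n)
    · exact hdec _ _
    · exact hdec _ _
  choose y hyT hy using fun n m => (T n).2.exists_gt m
  let x : ℕ → ℕ := fun n => Nat.rec (y 0 0) (fun r z => y (r + 1) z) n
  have hx : ∀ n, x n ∈ (T n).1 := by
    rintro (_ | n)
    · exact hyT 0 0
    · exact hyT (n + 1) (x n)
  exact ⟨x, strictMono_nat_of_lt_succ fun n => hy (n + 1) (x n), fun n =>
    ⟨(T n).1, fun r hr => hT hr (hx r), hTdec n⟩⟩

theorem IsIdealN.biUnion_mem {c : Set (Set ℕ)} (hc : IsIdealN c) {F : ℕ → Set ℕ}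
    (hF : ∀ n, F n ∈ c) {S : Set ℕ} (hS : S.Finite) : (⋃ k ∈ S, F k) ∈ c := by
  induction S, hS using Set.Finite.induction_on with
  | empty => exact hc.2 _ _ (hF 0) (by simp)
  | insert _ _ ih =>
    rw [Set.biUnion_insert]
    exact hc.1 _ _ (hF _) ih

/-- A sequence of members common to countably many ideals has a subsequence such that each
of the ideals contains either all or none of the infinite unions along it. -/
theorem exists_strictMono_biUnion_mem_or_notMem {C : Set (Set (Set ℕ))} (hC : C.Countable)
    (hid : ∀ c ∈ C, IsIdealN c) {D : ℕ → Set ℕ} (hD : ∀ c ∈ C, ∀ n, D n ∈ c) :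
    ∃ x : ℕ → ℕ, StrictMono x ∧ ∀ c ∈ C,
      (∀ S : Set ℕ, S.Infinite → (⋃ k ∈ S, D (x k)) ∈ c) ∨
      (∀ S : Set ℕ, S.Infinite → (⋃ k ∈ S, D (x k)) ∉ c) := by
  rcases C.eq_empty_or_nonempty with rfl | hne
  · exact ⟨id, strictMono_id, by simp⟩
  obtain ⟨f, rfl⟩ := hC.exists_eq_range hne
  obtain ⟨x, hx, hdec⟩ := exists_strictMono_decides fun n S => (⋃ k ∈ S, D k) ∈ f n
  refine ⟨x, hx, ?_⟩
  rintro _ ⟨n, rfl⟩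
  have hcn := hid _ (Set.mem_range_self n)
  obtain ⟨T, hT, hno | hyes⟩ := hdec n
  · right
    intro S hS hmem
    have hinf : (x '' (S \ Set.Iio n)).Infinite :=
      (hS.sdiff (Set.finite_Iio n)).image hx.injective.injOn
    refine hno _ ?_ hinf (hcn.2 _ _ hmem ?_)
    · rintro _ ⟨r, hr, rfl⟩
      exact hT r (not_lt.1 hr.2)
    · rw [Set.biUnion_image]
      exact Set.biUnion_subset_biUnion_left Set.sdiff_subset
  · left
    intro S _
    have hfin := hcn.biUnion_mem (fun r => hD _ (Set.mem_range_self n) (x r)) (Set.finite_Iio n)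
    refine hcn.2 _ _ (hcn.1 _ _ hfin hyes) ?_
    refine Set.iUnion₂_subset fun r _ => ?_
    by_cases hr : r < n
    · exact (Set.subset_biUnion_of_mem (u := fun r => D (x r)) (Set.mem_Iio.2 hr)).trans
        Set.subset_union_left
    · exact (Set.subset_biUnion_of_mem (u := D) (hT r (not_lt.1 hr))).trans
        Set.subset_union_right

theorem exists_maximal_isMuchLargerChainLG {i j : Set (Set ℕ)} (hi : IsIdealN i) (hj : IsIdealN j)
    (h : MuchLarger i j) :
    ∃ C : Set (Set (Set ℕ)), IsMuchLargerChainLG i j C ∧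
      ∀ C' : Set (Set (Set ℕ)), IsMuchLargerChainLG i j C' → C ⊆ C' → C' = C := by
  have h₀ : IsMuchLargerChainLG i j {i, j} := by
    refine ⟨?_, ?_, by simp, by simp, ?_⟩
    · rintro k (rfl | rfl) <;> assumption
    · exact IsChain.pair h
    · rintro k (rfl | rfl) h₁ h₂
      · exact absurd rfl h₁
      · exact absurd rfl h₂
  obtain ⟨C, -, hC⟩ := zorn_subset_nonempty {C | IsMuchLargerChainLG i j C} (by
    intro c hc hchain hne
    refine ⟨⋃₀ c, ⟨?_, ?_, ?_, ?_, ?_⟩, fun s hs => Set.subset_sUnion_of_mem hs⟩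
    · rintro k ⟨s, hs, hk⟩
      exact (hc hs).1 k hk
    · exact (Set.pairwise_sUnion hchain.directedOn).2 fun s hs => (hc hs).2.1
    · obtain ⟨s, hs⟩ := hne
      exact ⟨s, hs, (hc hs).2.2.1⟩
    · obtain ⟨s, hs⟩ := hne
      exact ⟨s, hs, (hc hs).2.2.2.1⟩
    · rintro k ⟨s, hs, hk⟩
      exact (hc hs).2.2.2.2 k hk) _ h₀
  exact ⟨C, hC.1, fun C' hC' hsub => (hC.2 hC' hsub).antisymm hsub⟩

/-- A countable chain of ideals admits a cut into two parts with an ideal that is much larger than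
the members of the lower part and much smaller than the members of the upper part. -/
theorem IsMuchLargerChainLG.exists_isIdealN_between {i j : Set (Set ℕ)} {C : Set (Set (Set ℕ))}
    (h : MuchLarger i j) (hC : IsMuchLargerChainLG i j C) (hcount : C.Countable) :
    ∃ m, IsIdealN m ∧ MuchLarger i m ∧ MuchLarger m j ∧
      ∀ c ∈ C, MuchLarger c m ∨ MuchLarger m c := by
  obtain ⟨hid, hchain, hiC, hjC, hLG⟩ := hC
  obtain ⟨hij, D, hDi, hDne, hDdisj, hDu⟩ := h
  have hisub : ∀ c ∈ C, i ⊆ c := by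
    intro c hc
    by_cases h₁ : c = i
    · exact h₁.ge
    by_cases h₂ : c = j
    · exact h₂ ▸ hij.subset
    exact (hLG c hc h₁ h₂).1.1.subset
  have htot : ∀ a ∈ C, ∀ b ∈ C, a ⊆ b ∨ b ⊆ a := by
    intro a ha b hb
    by_cases hab : a = b
    · exact Or.inl hab.le
    · exact (hchain ha hb hab).imp (fun h => h.1.subset) fun h => h.1.subset
  obtain ⟨x, hx, hdec⟩ := exists_strictMono_biUnion_mem_or_notMem hcount hid
    fun c hc n => hisub c hc (hDi n)
  set F : ℕ → Set ℕ := fun n => D (x n) with hF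
  have hFdisj : ∀ m n, m ≠ n → Disjoint (F m) (F n) := fun m n hmn =>
    hDdisj _ _ (hx.injective.ne hmn)
  have himg : ∀ S : Set ℕ, (⋃ k ∈ S, F k) = ⋃ k ∈ x '' S, D k := fun S => by
    rw [Set.biUnion_image]
  have hilow : ∀ S : Set ℕ, S.Infinite → (⋃ k ∈ S, F k) ∉ i := fun S hS =>
    himg S ▸ (hDu _ (hS.image hx.injective.injOn)).2
  have hjup : ∀ S : Set ℕ, S.Infinite → (⋃ k ∈ S, F k) ∈ j := fun S hS =>
    himg S ▸ (hDu _ (hS.image hx.injective.injOn)).1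
  have hlt : ∀ a ∈ C, (∀ S : Set ℕ, S.Infinite → (⋃ k ∈ S, F k) ∉ a) → ∀ b ∈ C,
      (∀ S : Set ℕ, S.Infinite → (⋃ k ∈ S, F k) ∈ b) → a ⊆ b := fun a ha hla b hb hub =>
    (htot a ha b hb).resolve_right fun hba =>
      hla _ Set.infinite_univ (hba (hub _ Set.infinite_univ))
  have hEinj : Function.Injective fun n : ℕ => 2 * n := fun a b hab => by simpa using hab
  have hOinj : Function.Injective fun n : ℕ => 2 * n + 1 := fun a b hab => by simpa using hab
  set E : Set ℕ := ⋃ n, F (2 * n) with hE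
  let m : Set (Set ℕ) := {X | ∃ a ∈ C, (∀ S : Set ℕ, S.Infinite → (⋃ k ∈ S, F k) ∉ a) ∧
    ∃ Y ∈ a, X ⊆ Y ∪ E}
  have hm : IsIdealN m := by
    refine ⟨?_, fun X Z ⟨a, ha, hla, Y, hY, hXY⟩ hZX => ⟨a, ha, hla, Y, hY, hZX.trans hXY⟩⟩
    rintro X X' ⟨a, ha, hla, Y, hY, hXY⟩ ⟨a', ha', hla', Y', hY', hXY'⟩
    have hsub : X ∪ X' ⊆ (Y ∪ Y') ∪ E :=
      Set.union_subset
        (hXY.trans (Set.union_subset_union_left _ Set.subset_union_left))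
        (hXY'.trans (Set.union_subset_union_left _ Set.subset_union_right))
    rcases htot a ha a' ha' with h | h
    · exact ⟨a', ha', hla', _, (hid a' ha').1 _ _ (h hY) hY', hsub⟩
    · exact ⟨a, ha, hla, _, (hid a ha).1 _ _ hY (h hY'), hsub⟩
  have hlow : ∀ a ∈ C, (∀ S : Set ℕ, S.Infinite → (⋃ k ∈ S, F k) ∉ a) → MuchLarger a m := by
    intro a ha hla
    have hmem : ∀ K : Set ℕ, K.Infinite →
        (⋃ k ∈ K, F (2 * k)) ∈ m ∧ (⋃ k ∈ K, F (2 * k)) ∉ a := by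
      intro K hK
      refine ⟨⟨a, ha, hla, ∅, (hid a ha).2 _ _ (hisub a ha (hDi 0)) (Set.empty_subset _), ?_⟩, ?_⟩
      · rw [Set.empty_union]
        exact Set.iUnion₂_subset fun k _ => Set.subset_iUnion (fun n => F (2 * n)) k
      · have := hla _ (hK.image hEinj.injOn)
        rwa [Set.biUnion_image] at this
    refine ⟨⟨fun X hX => ⟨a, ha, hla, X, hX, Set.subset_union_left⟩, fun hma => ?_⟩,
      fun n => F (2 * n), fun n => hisub a ha (hDi _), fun n => hDne _,
      fun r s hrs => hFdisj _ _ (hEinj.ne hrs), hmem⟩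
    have := hmem _ Set.infinite_univ
    exact this.2 (hma this.1)
  have hup : ∀ b ∈ C, (∀ S : Set ℕ, S.Infinite → (⋃ k ∈ S, F k) ∈ b) → MuchLarger m b := by
    intro b hb hub
    have hmem : ∀ K : Set ℕ, K.Infinite →
        (⋃ k ∈ K, F (2 * k + 1)) ∈ b ∧ (⋃ k ∈ K, F (2 * k + 1)) ∉ m := by
      intro K hK
      have himage := hK.image hOinj.injOn
      refine ⟨?_, ?_⟩
      · have := hub _ himage
        rwa [Set.biUnion_image] at this
      · rintro ⟨a, ha, hla, Y, hY, hsub⟩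
        have hla' := hla _ himage
        rw [Set.biUnion_image] at hla'
        refine hla' ((hid a ha).2 _ _ hY ?_)
        refine Disjoint.subset_left_of_subset_union hsub ?_
        simp only [hE, Set.disjoint_iUnion_left, Set.disjoint_iUnion_right]
        intro r s _
        exact hFdisj _ _ (by omega)
    refine ⟨⟨?_, fun hbm => ?_⟩, fun n => F (2 * n + 1),
      fun n => (hlow i hiC hilow).1.subset (hDi _), fun n => hDne _,
      fun r s hrs => hFdisj _ _ (hOinj.ne hrs), hmem⟩
    · rintro X ⟨a, ha, hla, Y, hY, hXY⟩
      have hEb : E ∈ b := by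
        have := hub _ (Set.infinite_range_of_injective hEinj)
        rwa [Set.biUnion_range] at this
      exact (hid b hb).2 _ _ ((hid b hb).1 _ _ (hlt a ha hla b hb hub hY) hEb) hXY
    · have := hmem _ Set.infinite_univ
      exact this.2 (hbm this.1)
  exact ⟨m, hm, hlow i hiC hilow, hup j hjC hjup,
    fun c hc => (hdec c hc).elim (fun h => Or.inr (hup c hc h)) fun h => Or.inl (hlow c hc h)⟩

/-- If `𝐢 ⋐ 𝐣`, there exists a maximal `⋐`-chain of ideals with least element `𝐢`
and greatest element `𝐣`, and every such maximal chain is uncountable. -/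
theorem exists_maximal_muchLarger_chain_and_uncountable
    (i j : Set (Set ℕ)) (hi : IsIdealN i) (hj : IsIdealN j) (h : MuchLarger i j) :
    (∃ C : Set (Set (Set ℕ)), IsMuchLargerChainLG i j C ∧
      ∀ C' : Set (Set (Set ℕ)), IsMuchLargerChainLG i j C' → C ⊆ C' → C' = C) ∧
    (∀ C : Set (Set (Set ℕ)), IsMuchLargerChainLG i j C →
      (∀ C' : Set (Set (Set ℕ)), IsMuchLargerChainLG i j C' → C ⊆ C' → C' = C) →
      ¬ C.Countable) := by
  refine ⟨exists_maximal_isMuchLargerChainLG hi hj h, fun C hC hmax hcount => ?_⟩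
  obtain ⟨m, hm, him, hmj, hcm⟩ := hC.exists_isIdealN_between h hcount
  have hins : IsMuchLargerChainLG i j (insert m C) := by
    refine ⟨?_, ?_, Or.inr hC.2.2.1, Or.inr hC.2.2.2.1, ?_⟩
    · rintro k (rfl | hk)
      · exact hm
      · exact hC.1 k hk
    · exact hC.2.1.insert fun c hc _ => (hcm c hc).symm
    · rintro k (rfl | hk) h₁ h₂
      · exact ⟨him, hmj⟩
      · exact hC.2.2.2.2 k hk h₁ h₂
  have hmC : m ∈ C := hmax _ hins (Set.subset_insert m C) ▸ Set.mem_insert m C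
  exact (hcm m hmC).elim (fun h => h.1.ne rfl) fun h => h.1.ne rfl
end

section
/- Let 𝐢 and 𝐣 be ideals in ℕ with 𝐢 ⋐ 𝐣, and let Ω denote the first uncountable ordinal. Then there exists a transfinite sequence {B_α}_{α∈Ω} of infinite subsets of ℕ with B_α ∈ 𝐣 \ 𝐢 for every α ∈ Ω, which is strictly 𝐢-increasing: for all α < β < Ω, B_α ⊆ B_β mod 𝐢 and B_β \ B_α ∉ 𝐢. -/
/-- `C ⊆ D mod 𝐢`: there is `I ∈ 𝐢` with `C ⊆ D ∪ I`. -/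
def ModSubset (i : Set (Set ℕ)) (C D : Set ℕ) : Prop := ∃ I ∈ i, C ⊆ D ∪ I

open Filter in
/-- Countably many functions `ℕ → ℕ` are strictly eventually dominated by a single one. -/
theorem exists_forall_eventually_lt {ι : Type*} [Countable ι] (u : ι → ℕ → ℕ) :
    ∃ g : ℕ → ℕ, ∀ a, ∀ᶠ n in atTop, u a n < g n := by
  classical
  obtain ⟨e, he⟩ := exists_injective_nat ι
  have hfin (n : ℕ) : {a | e a ≤ n}.Finite := (Set.finite_Iic n).preimage he.injOn
  refine ⟨fun n => (∑ a ∈ (hfin n).toFinset, u a n) + 1, fun a => ?_⟩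
  filter_upwards [eventually_ge_atTop (e a)] with n hn
  have hle := Finset.single_le_sum (f := fun b => u b n) (s := (hfin n).toFinset)
    (fun _ _ => Nat.zero_le _) ((hfin n).mem_toFinset.2 hn)
  exact Nat.lt_succ_of_le hle

open Classical in
/-- A transfinite sequence of functions `ℕ → ℕ` in which every term of countable index
strictly eventually dominates all the previous ones. -/
noncomputable def dominatingSequence (α : Ordinal) : ℕ → ℕ :=
  if h : Countable (Set.Iio α) then
    Classical.choose (exists_forall_eventually_lt
      (fun β : Set.Iio α => dominatingSequence β.1))
  else 0
termination_by α
decreasing_by all_goals exact Subtype.prop _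

open Filter in
theorem dominatingSequence_eventually_lt {α β : Ordinal} (hαβ : α < β)
    (hβ : Countable (Set.Iio β)) :
    ∀ᶠ n in atTop, dominatingSequence α n < dominatingSequence β n := by
  rw [dominatingSequence.eq_def β, dif_pos hβ]
  exact Classical.choose_spec (exists_forall_eventually_lt
    (fun γ : Set.Iio β => dominatingSequence γ.1)) ⟨α, hαβ⟩

theorem countable_Iio_of_lt_ord_aleph_one {α : Ordinal} (h : α < (Cardinal.aleph 1).ord) :
    Countable (Set.Iio α) := by
  rw [← Cardinal.mk_le_aleph0_iff, Cardinal.mk_Iio_ordinal, Cardinal.lift_le_aleph0,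
    ← Order.lt_succ_iff, Cardinal.succ_aleph0]
  exact Cardinal.lt_ord.1 h

/-- The codes of the pairs lying on or below the graph of `f`. -/
def subgraphCodes (f : ℕ → ℕ) : Set ℕ := {k | k.unpair.2 ≤ f k.unpair.1}

theorem infinite_subgraphCodes (f : ℕ → ℕ) : (subgraphCodes f).Infinite := by
  refine Set.infinite_of_injective_forall_mem (f := fun n => Nat.pair n 0) (fun m n h => ?_)
    fun n => by simp [subgraphCodes]
  exact (Nat.pair_eq_pair.1 h).1

open Filter in
theorem finite_subgraphCodes_diff {f g : ℕ → ℕ} (h : ∀ᶠ n in atTop, f n < g n) :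
    (subgraphCodes f \ subgraphCodes g).Finite := by
  obtain ⟨N, hN⟩ := eventually_atTop.1 h
  have hfin : (⋃ n ∈ Set.Iio N, Nat.pair n '' Set.Iic (f n)).Finite :=
    (Set.finite_Iio N).biUnion fun n _ => (Set.finite_Iic (f n)).image _
  refine hfin.subset fun k hk => ?_
  obtain ⟨hkf, hkg⟩ := hk
  simp only [subgraphCodes, Set.mem_ofPred_eq] at hkf hkg
  simp only [Set.mem_iUnion]
  refine ⟨k.unpair.1, ?_, k.unpair.2, hkf, Nat.pair_unpair k⟩
  by_contra hlt
  exact hkg (hkf.trans (hN _ (not_lt.1 hlt)).le)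

open Filter in
theorem infinite_subgraphCodes_diff {f g : ℕ → ℕ} (h : ∀ᶠ n in atTop, f n < g n) :
    (subgraphCodes g \ subgraphCodes f).Infinite := by
  obtain ⟨N, hN⟩ := eventually_atTop.1 h
  refine Set.infinite_of_injective_forall_mem
    (f := fun n => Nat.pair (N + n) (g (N + n))) (fun m n hmn => ?_) fun n => ?_
  · exact Nat.add_left_cancel (Nat.pair_eq_pair.1 hmn).1
  · simpa [subgraphCodes] using hN (N + n) (Nat.le_add_right _ _)

theorem IsIdealN.biUnion_mem_s5 {i : Set (Set ℕ)} (hi : IsIdealN i) {D : ℕ → Set ℕ}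
    (hD : ∀ n, D n ∈ i) {K : Set ℕ} (hK : K.Finite) : (⋃ k ∈ K, D k) ∈ i := by
  induction K, hK using Set.Finite.induction_on with
  | empty => exact hi.2 _ _ (hD 0) (by simp)
  | insert _ _ ih =>
    rw [Set.biUnion_insert]
    exact hi.1 _ _ (hD _) ih

theorem infinite_biUnion_of_disjoint {D : ℕ → Set ℕ} (hne : ∀ n, (D n).Nonempty)
    (hdisj : ∀ m n, m ≠ n → Disjoint (D m) (D n)) {K : Set ℕ} (hK : K.Infinite) :
    (⋃ k ∈ K, D k).Infinite := by
  choose x hx using hne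
  have hinj : Function.Injective x := fun m n hmn => by
    by_contra hne
    exact Set.disjoint_left.1 (hdisj m n hne) (hx m) (hmn ▸ hx n)
  refine (hK.image hinj.injOn).mono ?_
  rintro _ ⟨k, hk, rfl⟩
  exact Set.mem_biUnion hk (hx k)

theorem biUnion_diff_subset_of_disjoint {D : ℕ → Set ℕ}
    (hdisj : ∀ m n, m ≠ n → Disjoint (D m) (D n)) (K L : Set ℕ) :
    (⋃ k ∈ K \ L, D k) ⊆ (⋃ k ∈ K, D k) \ ⋃ k ∈ L, D k := by
  intro x hx
  simp only [Set.mem_iUnion] at hx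
  obtain ⟨k, hk, hxk⟩ := hx
  refine ⟨Set.mem_biUnion hk.1 hxk, fun hxL => ?_⟩
  simp only [Set.mem_iUnion] at hxL
  obtain ⟨l, hl, hxl⟩ := hxL
  exact Set.disjoint_left.1 (hdisj k l fun hkl => hk.2 (hkl ▸ hl)) hxk hxl

/-- If `𝐢 ⋐ 𝐣` then there is a strictly `𝐢`-increasing transfinite sequence, indexed by
the first uncountable ordinal, of infinite sets belonging to `𝐣 \ 𝐢`. -/
theorem exists_strictly_i_increasing_transfinite_sequence_in_j_diff_i
    (i j : Set (Set ℕ)) (hi : IsIdealN i) (hj : IsIdealN j) (h : MuchLarger i j) :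
    ∃ B : Ordinal → Set ℕ,
      (∀ α, α < (Cardinal.aleph 1).ord → (B α).Infinite ∧ B α ∈ j ∧ B α ∉ i) ∧
      (∀ α β, α < β → β < (Cardinal.aleph 1).ord →
        ModSubset i (B α) (B β) ∧ (B β \ B α) ∉ i) := by
  obtain ⟨-, D, hD, hne, hdisj, hK⟩ := h
  refine ⟨fun α => ⋃ k ∈ subgraphCodes (dominatingSequence α), D k, fun α _ => ?_,
    fun α β hαβ hβ => ?_⟩
  · have hinf := infinite_subgraphCodes (dominatingSequence α)
    exact ⟨infinite_biUnion_of_disjoint hne hdisj hinf, hK _ hinf⟩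
  · have hlt := dominatingSequence_eventually_lt hαβ (countable_Iio_of_lt_ord_aleph_one hβ)
    refine ⟨⟨_, hi.biUnion_mem_s5 hD (finite_subgraphCodes_diff hlt), ?_⟩, fun hmem => ?_⟩
    · rw [← Set.biUnion_union, Set.union_sdiff_self]
      exact Set.biUnion_subset_biUnion_left Set.subset_union_right
    · exact (hK _ (infinite_subgraphCodes_diff hlt)).2
        (hi.2 _ _ hmem (biUnion_diff_subset_of_disjoint hdisj _ _))
end

section
/- For every set X ⊆ ℕ, the Buck density of X equals the tile density of X: inf{ d(B) : B ∈ ℛ, X ⊆ B mod 𝐟 } = inf{ d(A) : A ∈ 𝒯, X ⊆ A mod 𝐟 }. -/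
open Filter

/-- The ideal `𝐟` of all finite subsets of `ℕ`. -/
def finIdeal : Set (Set ℕ) := {A : Set ℕ | A.Finite}

/-- `C ⊆ D mod 𝐟`: the set `C \ D` is finite. -/
def ModF (C D : Set ℕ) : Prop := (C \ D).Finite

/-- The infinite arithmetic progression `a ℕ₀ + b = {a k + b : k ∈ ℕ₀}`. -/
def apSet (a b : ℕ) : Set ℕ := {m : ℕ | ∃ k : ℕ, m = a * k + b}

/-- `ℛ`: the set of all finite unions of infinite arithmetic progressions
`⋃_{i=1}^n (a_i ℕ₀ + b_i)` with `n ∈ ℕ` and `a_i, b_i ∈ ℕ = {1, 2, 3, …}`. -/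
def calR : Set (Set ℕ) :=
  {B : Set ℕ | ∃ n : ℕ, ∃ a b : Fin (n + 1) → ℕ,
    (∀ i, 0 < a i) ∧ (∀ i, 0 < b i) ∧ B = ⋃ i, apSet (a i) (b i)}

/-- The infinite tiling `(⋃_{j=0}^∞ (T + j r)) + b` of a tile `T` of length `r`. -/
def tiling (r b : ℕ) (T : Set ℕ) : Set ℕ :=
  {m : ℕ | ∃ t ∈ T, ∃ j : ℕ, m = t + j * r + b}

/-- `𝒯`: the set of all infinite tilings `(⋃_{j=0}^∞ (T + j r)) + b` with
`r, b ∈ ℕ = {1, 2, 3, …}` and `T ⊆ {0, 1, …, r - 1}` a tile of length `r`. -/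
def calT : Set (Set ℕ) :=
  {A : Set ℕ | ∃ r b : ℕ, 0 < r ∧ 0 < b ∧
    ∃ T : Set ℕ, T ⊆ Set.Iio r ∧ A = tiling r b T}

/-- `|X ∩ [1, n]|`. -/
noncomputable def cnt (X : Set ℕ) (n : ℕ) : ℕ := Nat.card ↥(X ∩ Set.Icc 1 n)

/-- `X` has density `δ`, i.e. `d(X) := lim_{n→∞} |X ∩ [1,n]| / n = δ`. -/
def HasDensity (X : Set ℕ) (δ : ℝ) : Prop :=
  Tendsto (fun n : ℕ => (cnt X n : ℝ) / n) atTop (nhds δ)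

/-- The ideal `𝐝` of all subsets of `ℕ` with density zero. -/
def densIdeal : Set (Set ℕ) := {X : Set ℕ | HasDensity X 0}

/-- `|X ∩ [k+1, k+n]|`. -/
noncomputable def cntI (X : Set ℕ) (k n : ℕ) : ℕ := Nat.card ↥(X ∩ Set.Icc (k + 1) (k + n))

/-- `max_{k ∈ ℕ₀} |X ∩ [k+1, k+n]|`. -/
noncomputable def maxCnt (X : Set ℕ) (n : ℕ) : ℕ := sSup {m : ℕ | ∃ k : ℕ, m = cntI X k n}

/-- The ideal `𝐛` of all subsets of `ℕ` with Banach density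
`b(X) := lim_{n→∞} max_{k∈ℕ₀} |X ∩ [k+1, k+n]| / n` equal to zero. -/
def banachIdeal : Set (Set ℕ) :=
  {X : Set ℕ | Tendsto (fun n : ℕ => (maxCnt X n : ℝ) / n) atTop (nhds 0)}

/-- The tile density `tile(X) := inf { d(A) : A ∈ 𝒯, X ⊆ A mod 𝐟 }`. -/
noncomputable def tileDens (X : Set ℕ) : ℝ :=
  sInf {δ : ℝ | ∃ A ∈ calT, ModF X A ∧ HasDensity A δ}

/-- The ideal `𝐭` of all subsets of `ℕ` with tile density zero. -/
def tileIdeal : Set (Set ℕ) := {X : Set ℕ | tileDens X = 0}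

/-- The Buck density `buck(X) := inf { d(B) : B ∈ ℛ, X ⊆ B mod 𝐟 }`. -/
noncomputable def buckDens (X : Set ℕ) : ℝ :=
  sInf {δ : ℝ | ∃ B ∈ calR, ModF X B ∧ HasDensity B δ}

/-- The ideal `𝐫` of all subsets of `ℕ` whose reciprocal series converges. -/
def recipIdeal : Set (Set ℕ) := {X : Set ℕ | Summable (X.indicator fun x : ℕ => (1 : ℝ) / x)}

/-- Removing elements of a set `A` outside `B` costs at most `|A \ B|` in the counting function. -/
theorem cnt_le_cnt_add_ncard_diff {A B : Set ℕ} (h : (A \ B).Finite) (n : ℕ) :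
    cnt A n ≤ cnt B n + (A \ B).ncard := by
  have hfin : (B ∩ Set.Icc 1 n).Finite := (Set.finite_Icc 1 n).inter_of_right _
  simp only [cnt, Nat.card_coe_set_eq]
  refine (Set.ncard_le_ncard ?_ (hfin.union h)).trans (Set.ncard_union_le _ _)
  rintro x ⟨hxA, hx⟩
  by_cases hxB : x ∈ B
  · exact Or.inl ⟨hxB, hx⟩
  · exact Or.inr ⟨hxA, hxB⟩

/-- Density is invariant under finite modifications. -/
theorem HasDensity.congr_modF {A B : Set ℕ} {δ : ℝ} (hA : HasDensity A δ)
    (hAB : ModF A B) (hBA : ModF B A) : HasDensity B δ := by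
  have hlow : Tendsto (fun n : ℕ => (cnt A n : ℝ) / n - ((A \ B).ncard : ℝ) / n)
      atTop (nhds δ) := by
    simpa using hA.sub (tendsto_const_div_atTop_nhds_zero_nat ((A \ B).ncard : ℝ))
  have hhigh : Tendsto (fun n : ℕ => (cnt A n : ℝ) / n + ((B \ A).ncard : ℝ) / n)
      atTop (nhds δ) := by
    simpa using hA.add (tendsto_const_div_atTop_nhds_zero_nat ((B \ A).ncard : ℝ))
  refine tendsto_of_tendsto_of_tendsto_of_le_of_le hlow hhigh (fun n => ?_) (fun n => ?_)
  · have h : (cnt A n : ℝ) ≤ cnt B n + (A \ B).ncard := by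
      exact_mod_cast cnt_le_cnt_add_ncard_diff hAB n
    simp only [← sub_div]
    gcongr
    linarith
  · have h : (cnt B n : ℝ) ≤ cnt A n + (B \ A).ncard := by
      exact_mod_cast cnt_le_cnt_add_ncard_diff hBA n
    simp only [← add_div]
    gcongr

theorem HasDensity.nonneg {A : Set ℕ} {δ : ℝ} (hA : HasDensity A δ) : 0 ≤ δ :=
  ge_of_tendsto' hA fun n => by positivity

/-- The set of positive multiples of `a` has density `1 / a`. -/
theorem hasDensity_apSet_self {a : ℕ} (ha : 0 < a) : HasDensity (apSet a a) ((a : ℝ)⁻¹) := by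
  have hcnt (n : ℕ) : cnt (apSet a a) n = n / a := by
    rw [← Nat.Ioc_filter_dvd_card_eq_div, cnt, Nat.card_coe_set_eq, ← Set.ncard_coe_finset]
    congr 1
    ext m
    simp only [apSet, Set.mem_inter_iff, Set.mem_ofPred_eq, Set.mem_Icc, Finset.coe_filter,
      Finset.mem_Ioc]
    constructor
    · rintro ⟨⟨k, rfl⟩, h⟩
      exact ⟨by omega, k + 1, by ring⟩
    · rintro ⟨h, k, rfl⟩
      obtain _ | k := k
      · simp at h
      · exact ⟨⟨k, by ring⟩, by omega⟩
  refine ((tendsto_nat_floor_mul_div_atTop (R := ℝ) (a := (a : ℝ)⁻¹) (by positivity)).comp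
    tendsto_natCast_atTop_atTop).congr fun n => ?_
  simp only [Function.comp_apply, hcnt]
  rw [inv_mul_eq_div, Nat.floor_div_eq_div]

theorem apSet_mem_calR {a b : ℕ} (ha : 0 < a) (hb : 0 < b) : apSet a b ∈ calR :=
  ⟨0, fun _ => a, fun _ => b, fun _ => ha, fun _ => hb, (Set.iUnion_const _).symm⟩

theorem add_mul_mem_apSet_iff {a b m r : ℕ} (har : a ∣ r) (hbm : b ≤ m) (j : ℕ) :
    m + j * r ∈ apSet a b ↔ m ∈ apSet a b := by
  obtain ⟨c, rfl⟩ := har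
  have key (x : ℕ) (hx : b ≤ x) : x ∈ apSet a b ↔ a ∣ x - b := by
    simp only [apSet, Set.mem_ofPred_eq, Dvd.dvd]
    exact exists_congr fun k => by omega
  rw [key _ hbm, key _ (by omega), Nat.sub_add_comm hbm]
  exact Nat.dvd_add_left ⟨j * c, by ring⟩

/-- Beyond some point, every member of `ℛ` is an infinite tiling. -/
theorem exists_inter_Ici_mem_calT {B : Set ℕ} (hB : B ∈ calR) : ∃ b, B ∩ Set.Ici b ∈ calT := by
  obtain ⟨n, a, b, ha, hb, rfl⟩ := hB
  set r := ∏ i, a i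
  set s := ∑ i, b i
  have hr : 0 < r := Finset.prod_pos fun i _ => ha i
  have hbs (i) : b i ≤ s := Finset.single_le_sum (fun _ _ => Nat.zero_le _) (Finset.mem_univ i)
  have hper (m j : ℕ) (hm : s ≤ m) :
      m + j * r ∈ ⋃ i, apSet (a i) (b i) ↔ m ∈ ⋃ i, apSet (a i) (b i) := by
    simp only [Set.mem_iUnion]
    exact exists_congr fun i => add_mul_mem_apSet_iff
      (Finset.dvd_prod_of_mem a (Finset.mem_univ i)) ((hbs i).trans hm) j
  refine ⟨s, r, s, hr, (hb 0).trans_le (hbs 0),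
    {t | t < r ∧ t + s ∈ ⋃ i, apSet (a i) (b i)}, fun t ht => ht.1, ?_⟩
  ext m
  constructor
  · rintro ⟨hm, hsm⟩
    have hsm : s ≤ m := hsm
    have hdm := Nat.mod_add_div' (m - s) r
    have hmeq : m = (m - s) % r + (m - s) / r * r + s := by omega
    refine ⟨(m - s) % r, ⟨Nat.mod_lt _ hr, ?_⟩, (m - s) / r, hmeq⟩
    rw [← hper _ ((m - s) / r) (by omega), add_right_comm, ← hmeq]
    exact hm
  · rintro ⟨t, ⟨-, ht⟩, j, rfl⟩
    refine ⟨?_, Nat.le_add_left _ _⟩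
    rw [add_right_comm]
    exact (hper _ j (by omega)).2 ht

/-- An infinite tiling by a nonempty tile is a finite union of arithmetic progressions. -/
theorem tiling_mem_calR {r b : ℕ} {T : Set ℕ} (hr : 0 < r) (hb : 0 < b) (hT : T ⊆ Set.Iio r)
    (hne : T.Nonempty) : tiling r b T ∈ calR := by
  obtain ⟨t₀, ht₀⟩ := hne
  classical
  let f : ℕ → ℕ := fun i => if i ∈ T then i else t₀
  have hf (i) : f i ∈ T := by
    by_cases h : i ∈ T <;> simp [f, h, ht₀]
  refine ⟨r, fun _ => r, fun i => f i + b, fun _ => hr, fun i => Nat.add_pos_right _ hb, ?_⟩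
  ext m
  simp only [tiling, apSet, Set.mem_ofPred_eq, Set.mem_iUnion]
  constructor
  · rintro ⟨t, ht, j, rfl⟩
    have htr : t < r := hT ht
    refine ⟨⟨t, by omega⟩, j, ?_⟩
    simp only [f, ht, if_true]
    ring
  · rintro ⟨i, k, rfl⟩
    exact ⟨f i, hf i, k, by ring⟩

theorem buckDens_le {X B : Set ℕ} {δ : ℝ} (hB : B ∈ calR) (hX : ModF X B)
    (hδ : HasDensity B δ) : buckDens X ≤ δ :=
  csInf_le ⟨0, fun _ ⟨_, _, _, h⟩ => h.nonneg⟩ ⟨B, hB, hX, hδ⟩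

theorem tileDens_le {X A : Set ℕ} {δ : ℝ} (hA : A ∈ calT) (hX : ModF X A)
    (hδ : HasDensity A δ) : tileDens X ≤ δ :=
  csInf_le ⟨0, fun _ ⟨_, _, _, h⟩ => h.nonneg⟩ ⟨A, hA, hX, hδ⟩

theorem buckDens_nonpos_of_finite {X : Set ℕ} (hX : X.Finite) : buckDens X ≤ 0 := by
  refine ge_of_tendsto' (tendsto_inv_atTop_nhds_zero_nat (𝕜 := ℝ) |>.comp
    (tendsto_add_atTop_nat 1)) fun n => ?_
  exact buckDens_le (apSet_mem_calR n.succ_pos n.succ_pos) hX.sdiff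
    (hasDensity_apSet_self n.succ_pos)

/-- A member of `ℛ` covering `X` mod finite can be replaced by a member of `𝒯` of the same
density. -/
theorem exists_calT_of_calR {X B : Set ℕ} {δ : ℝ} (hB : B ∈ calR) (hX : ModF X B)
    (hδ : HasDensity B δ) : ∃ A ∈ calT, ModF X A ∧ HasDensity A δ := by
  obtain ⟨b, hb⟩ := exists_inter_Ici_mem_calT hB
  have hfin : ModF B (B ∩ Set.Ici b) :=
    (Set.finite_Iio b).subset fun x ⟨hxB, hx⟩ => by
      by_contra h
      exact hx ⟨hxB, Set.mem_Ici.2 (not_lt.1 (mt Set.mem_Iio.2 h))⟩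
  refine ⟨_, hb, (Set.Finite.union hX hfin).subset fun x ⟨hxX, hx⟩ => ?_,
    hδ.congr_modF hfin (by simp [ModF, Set.sdiff_eq_empty.2 Set.inter_subset_left])⟩
  by_cases hxB : x ∈ B
  · exact Or.inr ⟨hxB, hx⟩
  · exact Or.inl ⟨hxX, hxB⟩

/-- The Buck density and the tile density are identical. -/
theorem buckDens_eq_tileDens : ∀ X : Set ℕ, buckDens X = tileDens X := by
  intro X
  have hX : ModF X (apSet 1 1) :=
    (Set.finite_singleton 0).subset fun x ⟨_, hx⟩ => by
      by_contra h
      exact hx ⟨x - 1, by have : x ≠ 0 := h; omega⟩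
  have hmem : apSet 1 1 ∈ calR := apSet_mem_calR one_pos one_pos
  have hdens := hasDensity_apSet_self one_pos
  apply le_antisymm
  · refine le_csInf ⟨_, exists_calT_of_calR hmem hX hdens⟩ ?_
    rintro δ ⟨_, ⟨r, b, hr, hb, T, hT, rfl⟩, hXA, hδ⟩
    obtain rfl | hne := T.eq_empty_or_nonempty
    · refine (buckDens_nonpos_of_finite ?_).trans hδ.nonneg
      simpa [ModF, tiling] using hXA
    · exact buckDens_le (tiling_mem_calR hr hb hT hne) hXA hδ
  · refine le_csInf ⟨_, _, hmem, hX, hdens⟩ ?_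
    rintro δ ⟨B, hB, hXB, hδ⟩
    obtain ⟨A, hA, hXA, hAδ⟩ := exists_calT_of_calR hB hXB hδ
    exact tileDens_le hA hXA hAδ
end

section
/- The much larger inclusion 𝐛 ∩ 𝐫 ⋐ 𝐫 holds: 𝐛 ∩ 𝐫 ⊊ 𝐫 and there exists a countable collection {D_j}_{j∈ℕ} ⊆ 𝐛 ∩ 𝐫 of nonempty pairwise disjoint subsets of ℕ such that for every infinite subset K ⊆ ℕ, the union ⋃_{k∈K} D_k belongs to 𝐫 \ (𝐛 ∩ 𝐫). -/
open Filter

theorem cntI_le (X : Set ℕ) (k n : ℕ) : cntI X k n ≤ n := by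
  unfold cntI
  rw [Nat.card_coe_set_eq]
  calc (X ∩ Set.Icc (k + 1) (k + n)).ncard ≤ (Set.Icc (k + 1) (k + n)).ncard :=
        Set.ncard_le_ncard Set.inter_subset_right (Set.finite_Icc _ _)
    _ = n := by
        rw [← Finset.coe_Icc, Set.ncard_coe_finset, Nat.card_Icc]
        omega

theorem cntI_le_maxCnt (X : Set ℕ) (k n : ℕ) : cntI X k n ≤ maxCnt X n :=
  le_csSup ⟨n, by rintro _ ⟨k, rfl⟩; exact cntI_le X k n⟩ ⟨k, rfl⟩

theorem cntI_eq_of_Icc_subset {X : Set ℕ} {k n : ℕ} (h : Set.Icc (k + 1) (k + n) ⊆ X) :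
    cntI X k n = n := by
  unfold cntI
  rw [Set.inter_eq_right.2 h, Nat.card_coe_set_eq, ← Finset.coe_Icc, Set.ncard_coe_finset,
    Nat.card_Icc]
  omega

theorem maxCnt_le_ncard {X : Set ℕ} (hX : X.Finite) (n : ℕ) : maxCnt X n ≤ X.ncard := by
  refine csSup_le ⟨_, 0, rfl⟩ ?_
  rintro _ ⟨k, rfl⟩
  unfold cntI
  rw [Nat.card_coe_set_eq]
  exact Set.ncard_le_ncard Set.inter_subset_left hX

theorem mem_banachIdeal_of_finite {X : Set ℕ} (hX : X.Finite) : X ∈ banachIdeal := by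
  refine squeeze_zero (fun n => by positivity) (fun n => ?_)
    (tendsto_const_div_atTop_nhds_zero_nat (X.ncard : ℝ))
  have := maxCnt_le_ncard hX n
  gcongr

/-- A set containing arbitrarily long intervals does not have Banach density zero. -/
theorem notMem_banachIdeal_of_Icc_subset {X : Set ℕ}
    (h : ∀ n, ∃ k, Set.Icc (k + 1) (k + n) ⊆ X) : X ∉ banachIdeal := by
  intro hX
  have h1 : (1 : ℝ) ≤ 0 := by
    refine ge_of_tendsto hX ?_
    filter_upwards [eventually_gt_atTop 0] with n hn
    obtain ⟨k, hk⟩ := h n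
    have h2 := cntI_le_maxCnt X k n
    rw [cntI_eq_of_Icc_subset hk] at h2
    rw [one_le_div (by exact_mod_cast hn)]
    exact_mod_cast h2
  norm_num at h1

theorem recipIdeal_of_subset {X Y : Set ℕ} (h : X ⊆ Y) (hY : Y ∈ recipIdeal) :
    X ∈ recipIdeal :=
  Summable.of_nonneg_of_le (fun x => Set.indicator_nonneg (fun _ _ => by positivity) x)
    (fun x => Set.indicator_le_indicator_of_subset h (fun _ => by positivity) x) hY

/-- The block of length `j + 1` starting just after `4 ^ j`. -/
def sparseBlock (j : ℕ) : Set ℕ := Set.Icc (4 ^ j + 1) (4 ^ j + (j + 1))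

theorem sparseBlock_lt {i j x y : ℕ} (hij : i < j) (hx : x ∈ sparseBlock i)
    (hy : y ∈ sparseBlock j) : x < y := by
  have h1 : 4 ^ (i + 1) ≤ 4 ^ j := Nat.pow_le_pow_right (by norm_num) hij
  have h2 : i < 4 ^ i := Nat.lt_pow_self (by norm_num)
  simp only [sparseBlock, Set.mem_Icc] at hx hy
  rw [pow_succ] at h1
  omega

theorem sparseBlock_index_unique {i j x : ℕ} (hi : x ∈ sparseBlock i)
    (hj : x ∈ sparseBlock j) : i = j := by
  rcases lt_trichotomy i j with h | h | h
  · exact absurd (sparseBlock_lt h hi hj) (lt_irrefl x)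
  · exact h
  · exact absurd (sparseBlock_lt h hj hi) (lt_irrefl x)

theorem iUnion_sparseBlock_mem_recipIdeal : (⋃ j, sparseBlock j) ∈ recipIdeal := by
  let e : (Σ j : ℕ, Fin (j + 1)) → ℕ := fun p => 4 ^ p.1 + (p.2 + 1)
  have he (p : Σ j : ℕ, Fin (j + 1)) : e p ∈ sparseBlock p.1 := by
    have := p.2.2
    simp only [e, sparseBlock, Set.mem_Icc]
    omega
  have hinj : Function.Injective e := by
    rintro ⟨i, a⟩ ⟨j, b⟩ h
    obtain rfl : i = j := sparseBlock_index_unique (he ⟨i, a⟩) (h ▸ he ⟨j, b⟩)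
    have hab : a = b := Fin.ext (by simpa [e] using h)
    rw [hab]
  refine (hinj.summable_iff fun x hx => ?_).1 ?_
  · refine Set.indicator_of_notMem (fun hU => hx ?_) _
    obtain ⟨j, h1, h2⟩ := Set.mem_iUnion.1 hU
    refine ⟨⟨j, ⟨x - 4 ^ j - 1, by omega⟩⟩, ?_⟩
    simp only [e]
    omega
  · have hle (p : Σ j : ℕ, Fin (j + 1)) :
        ((⋃ j, sparseBlock j).indicator (fun x : ℕ => (1 : ℝ) / x) ∘ e) p ≤ 1 / 4 ^ p.1 := by
      rw [Function.comp_apply, Set.indicator_of_mem (Set.mem_iUnion.2 ⟨_, he p⟩)]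
      refine one_div_le_one_div_of_le (by positivity) ?_
      simp only [e]
      push_cast
      linarith [Nat.cast_nonneg (α := ℝ) (p.2 : ℕ)]
    refine Summable.of_nonneg_of_le
      (fun p => Set.indicator_nonneg (fun _ _ => by positivity) _) hle ?_
    refine (summable_sigma_of_nonneg fun p => by positivity).2 ⟨fun j => .of_finite, ?_⟩
    refine Summable.of_nonneg_of_le (fun j => tsum_nonneg fun _ => by positivity) (fun j => ?_)
      (summable_geometric_two)
    have h1 : ((j + 1 : ℕ) : ℝ) ≤ 2 ^ j := by exact_mod_cast Nat.lt_two_pow_self (n := j)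
    have h2 : (4 : ℝ) ^ j = 2 ^ j * 2 ^ j := by rw [← mul_pow]; norm_num
    simp only [tsum_fintype, Finset.sum_const, Finset.card_univ, Fintype.card_fin, nsmul_eq_mul]
    rw [h2, one_div_pow, mul_one_div, div_le_div_iff₀ (by positivity) (by positivity)]
    nlinarith [pow_pos (two_pos (α := ℝ)) j]

theorem biUnion_sparseBlock_notMem_banachIdeal {K : Set ℕ} (hK : K.Infinite) :
    (⋃ k ∈ K, sparseBlock k) ∉ banachIdeal := by
  refine notMem_banachIdeal_of_Icc_subset fun n => ?_
  obtain ⟨k, hk, hn⟩ := hK.exists_gt n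
  refine ⟨4 ^ k, fun x hx => Set.mem_biUnion hk ?_⟩
  simp only [sparseBlock, Set.mem_Icc] at hx ⊢
  omega

theorem sparseBlock_mem_recipIdeal (j : ℕ) : sparseBlock j ∈ recipIdeal :=
  recipIdeal_of_subset (Set.subset_iUnion _ j) iUnion_sparseBlock_mem_recipIdeal

theorem biUnion_sparseBlock_mem_recipIdeal (K : Set ℕ) :
    (⋃ k ∈ K, sparseBlock k) ∈ recipIdeal :=
  recipIdeal_of_subset (Set.iUnion₂_subset_iUnion _ _) iUnion_sparseBlock_mem_recipIdeal

/-- The much larger inclusion `𝐛 ∩ 𝐫 ⋐ 𝐫`. -/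
theorem banach_inter_recip_muchLarger_recip :
    MuchLarger (banachIdeal ∩ recipIdeal) recipIdeal := by
  refine ⟨⟨Set.inter_subset_right, fun h => ?_⟩, sparseBlock, fun n => ?_, fun n => ?_,
    fun m n hmn => ?_, fun K hK => ?_⟩
  · exact biUnion_sparseBlock_notMem_banachIdeal Set.infinite_univ
      (h (biUnion_sparseBlock_mem_recipIdeal Set.univ)).1
  · exact ⟨mem_banachIdeal_of_finite (Set.finite_Icc _ _), sparseBlock_mem_recipIdeal n⟩
  · exact ⟨4 ^ n + 1, by simp [sparseBlock]⟩
  · exact Set.disjoint_left.2 fun x hx hy => hmn (sparseBlock_index_unique hx hy)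
  · exact ⟨biUnion_sparseBlock_mem_recipIdeal K,
      fun h => biUnion_sparseBlock_notMem_banachIdeal hK h.1⟩
end

section
/- The much larger inclusion 𝐛 ∩ 𝐫 ⋐ 𝐛 holds: 𝐛 ∩ 𝐫 ⊊ 𝐛 and there exists a countable collection {D_j}_{j∈ℕ} ⊆ 𝐛 ∩ 𝐫 of nonempty pairwise disjoint subsets of ℕ such that for every infinite subset K ⊆ ℕ, the union ⋃_{k∈K} D_k belongs to 𝐛 \ (𝐛 ∩ 𝐫). -/
open Filter

theorem cntI_le_of_gaps {X : Set ℕ} {L N : ℕ}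
    (h : ∀ x ∈ X, ∀ y ∈ X, N ≤ x → x < y → x + L ≤ y) (hL : 0 < L) (k n : ℕ) :
    cntI X k n ≤ N + (n / L + 2) := by
  classical
  have hfin : (X ∩ Set.Icc (k + 1) (k + n)).Finite := (Set.finite_Icc _ _).inter_of_right _
  set S := hfin.toFinset with hS
  have hcard : cntI X k n = S.card := Nat.card_eq_card_finite_toFinset hfin
  have hsmall : (S.filter (· < N)).card ≤ N := by
    calc (S.filter (· < N)).card ≤ (Finset.range N).card :=
          Finset.card_le_card fun x hx => by simpa using (Finset.mem_filter.1 hx).2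
      _ = N := Finset.card_range N
  have hlarge : (S.filter (¬ · < N)).card ≤ n / L + 2 := by
    calc (S.filter (¬ · < N)).card
        ≤ (Finset.Icc (k / L) (k / L + (n / L + 1))).card := by
          refine Finset.card_le_card_of_injOn (· / L) ?_ ?_
          · intro x hx
            have hx' : x ∈ X ∩ Set.Icc (k + 1) (k + n) := by
              simpa [hS] using (Finset.mem_filter.1 hx).1
            obtain ⟨-, hx1, hx2⟩ := hx'
            simp only [Finset.coe_Icc, Set.mem_Icc]
            refine ⟨Nat.div_le_div_right (by omega), ?_⟩
            refine Nat.le_of_lt_succ ((Nat.div_lt_iff_lt_mul hL).2 ?_)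
            have h1 := Nat.lt_div_mul_add (a := k) hL
            have h2 := Nat.lt_div_mul_add (a := n) hL
            simp only [Nat.succ_eq_add_one, add_mul, one_mul]
            omega
          · have key : ∀ x ∈ X, ∀ y ∈ X, N ≤ x → x < y → x / L ≠ y / L := by
              intro x hx y hy hxN hxy he
              have h1 := Nat.div_le_div_right (c := L) (h x hx y hy hxN hxy)
              rw [Nat.add_div_right _ hL] at h1
              omega
            intro x hx y hy hxy
            simp only [Finset.coe_filter, Set.mem_ofPred_eq, not_lt, hS, Set.Finite.mem_toFinset,
              Set.mem_inter_iff] at hx hy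
            rcases lt_trichotomy x y with hlt | heq | hgt
            · exact absurd hxy (key x hx.1.1 y hy.1.1 hx.2 hlt)
            · exact heq
            · exact absurd hxy.symm (key y hy.1.1 x hx.1.1 hy.2 hgt)
      _ = n / L + 2 := by rw [Nat.card_Icc, add_assoc, Nat.add_sub_cancel_left]
  rw [hcard, ← Finset.card_filter_add_card_filter_not (s := S) (· < N)]
  exact add_le_add hsmall hlarge

/-- A set whose gaps tend to infinity has Banach density zero. -/
theorem mem_banachIdeal_of_gaps {X : Set ℕ}
    (h : ∀ L, ∃ N, ∀ x ∈ X, ∀ y ∈ X, N ≤ x → x < y → x + L ≤ y) : X ∈ banachIdeal := by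
  change Tendsto (fun n : ℕ => (maxCnt X n : ℝ) / n) atTop (nhds 0)
  rw [Metric.tendsto_atTop]
  intro ε hε
  obtain ⟨l, hl⟩ := exists_nat_one_div_lt (half_pos hε)
  obtain ⟨N, hN⟩ := h (l + 1)
  obtain ⟨M, hM⟩ := exists_nat_gt ((N + 2 : ℝ) / (ε / 2))
  refine ⟨M + 1, fun n hn => ?_⟩
  have hn0 : (0 : ℝ) < n := by exact_mod_cast (by omega : 0 < n)
  have hmax : maxCnt X n ≤ N + (n / (l + 1) + 2) := by
    refine csSup_le' ?_
    rintro m ⟨k, rfl⟩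
    exact cntI_le_of_gaps hN l.succ_pos k n
  have hmaxR : (maxCnt X n : ℝ) ≤ N + (n * (1 / (l + 1)) + 2) := by
    have h1 : ((n / (l + 1) : ℕ) : ℝ) ≤ n / ((l + 1 : ℕ) : ℝ) := Nat.cast_div_le
    have h2 : (maxCnt X n : ℝ) ≤ N + ((n / (l + 1) : ℕ) + 2) := by exact_mod_cast hmax
    push_cast at h1
    rw [mul_one_div]
    linarith
  have hMn : (M : ℝ) < n := by exact_mod_cast hn
  rw [div_lt_iff₀ (half_pos hε)] at hM
  rw [Real.dist_eq, sub_zero, abs_of_nonneg (by positivity), div_lt_iff₀ hn0]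
  nlinarith [mul_lt_mul_of_pos_left hl hn0, mul_lt_mul_of_pos_right hMn (half_pos hε)]

theorem half_le_sum_one_div_Ico_two_pow (a d : ℕ) :
    (d : ℝ) / 2 ≤ ∑ i ∈ Finset.Ico (2 ^ a : ℕ) (2 ^ (a + d)), (1 : ℝ) / i := by
  induction d with
  | zero => simp
  | succ d ih =>
    have h1 : 2 ^ a ≤ 2 ^ (a + d) := Nat.pow_le_pow_right (by norm_num) (by omega)
    have h2 : 2 ^ (a + d) ≤ 2 ^ (a + (d + 1)) := Nat.pow_le_pow_right (by norm_num) (by omega)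
    rw [← Finset.sum_Ico_consecutive _ h1 h2]
    have hblock : (1 : ℝ) / 2 ≤
        ∑ i ∈ Finset.Ico (2 ^ (a + d) : ℕ) (2 ^ (a + (d + 1))), (1 : ℝ) / i := by
      have hpt : ∀ i ∈ Finset.Ico (2 ^ (a + d) : ℕ) (2 ^ (a + (d + 1))),
          (1 : ℝ) / 2 ^ (a + d + 1) ≤ 1 / i := by
        intro i hi
        rw [Finset.mem_Ico] at hi
        have hi0 : (0 : ℝ) < i := by
          exact_mod_cast lt_of_lt_of_le (Nat.two_pow_pos _) hi.1
        refine one_div_le_one_div_of_le hi0 ?_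
        exact_mod_cast hi.2.le
      have := Finset.card_nsmul_le_sum _ _ _ hpt
      rw [Nat.card_Ico, nsmul_eq_mul] at this
      refine le_trans (le_of_eq ?_) this
      have hc : 2 ^ (a + (d + 1)) - 2 ^ (a + d) = 2 ^ (a + d) := by
        rw [← add_assoc, pow_succ]; omega
      rw [hc, pow_succ]
      push_cast
      field_simp
    push_cast
    linarith

/-- The multiples `(j + 1) i` of `j + 1` with `2 ^ (j (j + 1)) ≤ i < 2 ^ ((j + 1) (j + 2))`. -/
def multiplesBlock (j : ℕ) : Finset ℕ :=
  (Finset.Ico (2 ^ (j * (j + 1))) (2 ^ ((j + 1) * (j + 2)))).image ((j + 1) * ·)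

theorem mem_multiplesBlock {j x : ℕ} : x ∈ multiplesBlock j ↔
    ∃ i, 2 ^ (j * (j + 1)) ≤ i ∧ i < 2 ^ ((j + 1) * (j + 2)) ∧ (j + 1) * i = x := by
  simp [multiplesBlock, and_assoc]

theorem multiplesBlock_nonempty (j : ℕ) : (multiplesBlock j).Nonempty :=
  ⟨_, mem_multiplesBlock.2 ⟨_, le_rfl, Nat.pow_lt_pow_right (by norm_num) (by nlinarith), rfl⟩⟩

theorem lt_of_mem_multiplesBlock {j x : ℕ} (hx : x ∈ multiplesBlock j) : j < x := by
  obtain ⟨i, hi, -, rfl⟩ := mem_multiplesBlock.1 hx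
  have : 0 < i := lt_of_lt_of_le (Nat.two_pow_pos _) hi
  nlinarith

theorem add_le_of_mem_multiplesBlock_of_lt {i j x y : ℕ} (hij : i < j)
    (hx : x ∈ multiplesBlock i) (hy : y ∈ multiplesBlock j) : x + (i + 1) ≤ y := by
  obtain ⟨a, -, ha, rfl⟩ := mem_multiplesBlock.1 hx
  obtain ⟨b, hb, -, rfl⟩ := mem_multiplesBlock.1 hy
  have hpow : 2 ^ ((i + 1) * (i + 2)) ≤ 2 ^ (j * (j + 1)) :=
    Nat.pow_le_pow_right (by norm_num) (Nat.mul_le_mul hij (by omega))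
  have hlt : (i + 1) * (i + 2) < 2 ^ ((i + 1) * (i + 2)) := Nat.lt_two_pow_self
  nlinarith

theorem disjoint_multiplesBlock {i j : ℕ} (hij : i ≠ j) :
    Disjoint (multiplesBlock i) (multiplesBlock j) := by
  rw [Finset.disjoint_left]
  intro x hi hj
  rcases lt_or_gt_of_ne hij with h | h
  · have := add_le_of_mem_multiplesBlock_of_lt h hi hj
    omega
  · have := add_le_of_mem_multiplesBlock_of_lt h hj hi
    omega

theorem one_le_sum_multiplesBlock (j : ℕ) : 1 ≤ ∑ x ∈ multiplesBlock j, (1 : ℝ) / x := by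
  rw [multiplesBlock, Finset.sum_image fun a _ b _ h => Nat.eq_of_mul_eq_mul_left j.succ_pos h]
  have h := half_le_sum_one_div_Ico_two_pow (j * (j + 1)) (2 * (j + 1))
  rw [show j * (j + 1) + 2 * (j + 1) = (j + 1) * (j + 2) by ring] at h
  have hj : (0 : ℝ) < j + 1 := by positivity
  calc (1 : ℝ) = 1 / (j + 1) * (((2 * (j + 1) : ℕ) : ℝ) / 2) := by push_cast; field_simp
    _ ≤ 1 / (j + 1) * ∑ i ∈ Finset.Ico (2 ^ (j * (j + 1)) : ℕ) (2 ^ ((j + 1) * (j + 2))),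
        (1 : ℝ) / i := by gcongr
    _ = _ := by
      rw [Finset.mul_sum]
      refine Finset.sum_congr rfl fun i _ => ?_
      push_cast
      rw [one_div_mul_one_div]

theorem mem_banachIdeal_of_subset_iUnion_multiplesBlock {X : Set ℕ}
    (hX : X ⊆ ⋃ j, (multiplesBlock j : Set ℕ)) : X ∈ banachIdeal := by
  refine mem_banachIdeal_of_gaps fun L => ⟨L * 2 ^ (L * (L + 1)), fun x hx y hy hNx hxy => ?_⟩
  obtain ⟨i, hi⟩ := Set.mem_iUnion.1 (hX hx)
  obtain ⟨j, hj⟩ := Set.mem_iUnion.1 (hX hy)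
  rw [Finset.mem_coe] at hi hj
  have hLi : L ≤ i + 1 := by
    by_contra! hlt
    obtain ⟨a, -, ha, rfl⟩ := mem_multiplesBlock.1 hi
    have hpow : 2 ^ ((i + 1) * (i + 2)) ≤ 2 ^ (L * (L + 1)) :=
      Nat.pow_le_pow_right (by norm_num) (Nat.mul_le_mul hlt.le (by omega))
    have := Nat.mul_lt_mul_of_lt_of_le hlt (ha.le.trans hpow) (Nat.two_pow_pos _)
    omega
  rcases lt_trichotomy i j with h | rfl | h
  · have := add_le_of_mem_multiplesBlock_of_lt h hi hj
    omega
  · obtain ⟨a, -, -, rfl⟩ := mem_multiplesBlock.1 hi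
    obtain ⟨b, -, -, rfl⟩ := mem_multiplesBlock.1 hj
    have : a < b := Nat.lt_of_mul_lt_mul_left hxy
    nlinarith
  · have := add_le_of_mem_multiplesBlock_of_lt h hj hi
    omega

theorem biUnion_multiplesBlock_notMem_recipIdeal {K : Set ℕ} (hK : K.Infinite) :
    (⋃ k ∈ K, (multiplesBlock k : Set ℕ)) ∉ recipIdeal := by
  intro hsum
  obtain ⟨s, hs⟩ := summable_iff_vanishing_norm.1 hsum 1 one_pos
  obtain ⟨k, hkK, hk⟩ := hK.exists_gt (s.sup id)
  have hdisj : Disjoint (multiplesBlock k) s := by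
    rw [Finset.disjoint_left]
    intro x hx hxs
    have h1 := lt_of_mem_multiplesBlock hx
    have h2 : x ≤ s.sup id := Finset.le_sup (f := id) hxs
    omega
  refine absurd ((le_abs_self _).trans_lt (hs _ hdisj)) (not_lt.2 ?_)
  refine (one_le_sum_multiplesBlock k).trans_eq (Finset.sum_congr rfl fun x hx => ?_)
  rw [Set.indicator_of_mem (Set.mem_biUnion hkK hx)]

theorem finset_mem_recipIdeal (s : Finset ℕ) : (s : Set ℕ) ∈ recipIdeal :=
  summable_of_ne_finset_zero (s := s) fun _ hx => Set.indicator_of_notMem (by simpa using hx) _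

/-- The much larger inclusion `𝐛 ∩ 𝐫 ⋐ 𝐛`. -/
theorem banach_inter_recip_muchLarger_banach :
    MuchLarger (banachIdeal ∩ recipIdeal) banachIdeal := by
  have hunion : ∀ K : Set ℕ, K.Infinite → (⋃ k ∈ K, (multiplesBlock k : Set ℕ)) ∈ banachIdeal ∧
      (⋃ k ∈ K, (multiplesBlock k : Set ℕ)) ∉ banachIdeal ∩ recipIdeal := fun K hK =>
    ⟨mem_banachIdeal_of_subset_iUnion_multiplesBlock
      (Set.iUnion₂_subset_iUnion K fun k => (multiplesBlock k : Set ℕ)),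
      fun h => biUnion_multiplesBlock_notMem_recipIdeal hK h.2⟩
  refine ⟨⟨Set.inter_subset_left, fun h => ?_⟩, fun j => multiplesBlock j, fun j => ⟨?_, ?_⟩,
    fun j => ?_, fun i j hij => ?_, hunion⟩
  · have huniv := hunion Set.univ Set.infinite_univ
    exact huniv.2 (h huniv.1)
  · exact mem_banachIdeal_of_subset_iUnion_multiplesBlock
      (Set.subset_iUnion (fun k => (multiplesBlock k : Set ℕ)) j)
  · exact finset_mem_recipIdeal _
  · exact multiplesBlock_nonempty j
  · exact Finset.disjoint_coe.2 (disjoint_multiplesBlock hij)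
end

section
/- The much larger inclusion 𝐫 ⋐ 𝐝 holds: 𝐫 ⊊ 𝐝 is false in general as inclusion of sets, but more precisely 𝐫 ⊊ 𝐝 holds and there exists a countable collection {D_j}_{j∈ℕ} ⊆ 𝐫 of nonempty pairwise disjoint subsets of ℕ such that for every infinite subset K ⊆ ℕ, the union ⋃_{k∈K} D_k belongs to 𝐝 \ 𝐫. -/
open Filter

open Topology

theorem finite_inter_Icc (X : Set ℕ) (a b : ℕ) : (X ∩ Set.Icc a b).Finite :=
  (Set.finite_Icc a b).subset Set.inter_subset_right

theorem cnt_mono {X Y : Set ℕ} (h : X ⊆ Y) (n : ℕ) : cnt X n ≤ cnt Y n :=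
  Nat.card_mono (finite_inter_Icc Y 1 n) (Set.inter_subset_inter_left _ h)

theorem densIdeal_of_subset {X Y : Set ℕ} (h : X ⊆ Y) (hY : Y ∈ densIdeal) : X ∈ densIdeal :=
  squeeze_zero (fun n => by positivity)
    (fun n => by
      have := cnt_mono h n
      gcongr) hY

theorem cnt_div_eq_tsum (X : Set ℕ) (n : ℕ) :
    (cnt X n : ℝ) / n = ∑' x, (X ∩ Set.Icc 1 n).indicator (fun _ => (1 : ℝ) / n) x := by
  rw [← tsum_subtype, tsum_const, nsmul_eq_mul, mul_one_div]
  rfl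

theorem recipIdeal_subset_densIdeal : recipIdeal ⊆ densIdeal := by
  intro X hX
  have key : Tendsto
      (fun n : ℕ => ∑' x, (X ∩ Set.Icc 1 n).indicator (fun _ => (1 : ℝ) / n) x) atTop
      (𝓝 (∑' _ : ℕ, (0 : ℝ))) := by
    refine tendsto_tsum_of_dominated_convergence hX (fun x => ?_) (Eventually.of_forall ?_)
    · refine squeeze_zero (fun n => Set.indicator_nonneg (fun _ _ => by positivity) x)
        (fun n => Set.indicator_le_self' (fun _ _ => by positivity) x)
        tendsto_one_div_atTop_nhds_zero_nat
    · intro n x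
      rw [Real.norm_of_nonneg (Set.indicator_nonneg (fun _ _ => by positivity) x)]
      by_cases hx : x ∈ X ∩ Set.Icc 1 n
      · rw [Set.indicator_of_mem hx, Set.indicator_of_mem hx.1]
        have h1 : 0 < x := hx.2.1
        have h2 : x ≤ n := hx.2.2
        gcongr
      · rw [Set.indicator_of_notMem hx]
        exact Set.indicator_nonneg (fun _ _ => by positivity) x
  simpa only [densIdeal, HasDensity, Set.mem_ofPred_eq, cnt_div_eq_tsum, tsum_zero] using key

theorem cnt_setOf_prime (n : ℕ) : cnt {p | p.Prime} n = n.primeCounting := by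
  rw [← Nat.primesLE_card_eq_primeCounting, cnt, Nat.card_coe_set_eq, ← Set.ncard_coe_finset]
  congr 1
  ext p
  simp only [Set.mem_inter_iff, Set.mem_ofPred_eq, Set.mem_Icc, Finset.mem_coe, Nat.mem_primesLE]
  exact ⟨fun h => ⟨h.2.2, h.1⟩, fun h => ⟨h.2, h.2.one_lt.le, h.1⟩⟩

theorem setOf_prime_mem_densIdeal : {p : ℕ | p.Prime} ∈ densIdeal := by
  have hlog : Tendsto (fun n : ℕ => (Real.log 4 + 1) / Real.log n) atTop (𝓝 0) :=
    (Real.tendsto_log_atTop.comp tendsto_natCast_atTop_atTop).const_div_atTop _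
  refine squeeze_zero' (Eventually.of_forall fun n => by positivity) ?_ hlog
  filter_upwards [tendsto_natCast_atTop_atTop.eventually
    (Chebyshev.eventually_primeCounting_le one_pos), eventually_gt_atTop 0] with n hn hpos
  rw [Nat.floor_natCast] at hn
  have hpos' : (0 : ℝ) < n := by exact_mod_cast hpos
  rw [cnt_setOf_prime, div_le_iff₀ hpos']
  exact hn.trans_eq (by ring)

/-- The elements of `X` between consecutive terms of the sequence `a`. -/
def block (X : Set ℕ) (a : ℕ → ℕ) (j : ℕ) : Set ℕ := X ∩ Set.Ico (a j) (a (j + 1))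

theorem finite_block (X : Set ℕ) (a : ℕ → ℕ) (j : ℕ) : (block X a j).Finite :=
  (Set.finite_Ico _ _).subset Set.inter_subset_right

theorem disjoint_block (X : Set ℕ) {a : ℕ → ℕ} (ha : Monotone a) {m n : ℕ} (h : m ≠ n) :
    Disjoint (block X a m) (block X a n) :=
  (ha.pairwise_disjoint_on_Ico_succ h).mono Set.inter_subset_right Set.inter_subset_right

theorem mem_recipIdeal_of_finite {X : Set ℕ} (hX : X.Finite) : X ∈ recipIdeal :=
  summable_of_hasFiniteSupport (hX.subset Set.support_indicator_subset)

theorem exists_strictMono_one_le_sum_Ico {f : ℕ → ℝ} (hf : ∀ n, 0 ≤ f n) (h : ¬ Summable f) :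
    ∃ a : ℕ → ℕ, StrictMono a ∧ ∀ j, 1 ≤ ∑ i ∈ Finset.Ico (a j) (a (j + 1)), f i := by
  have hT := (not_summable_iff_tendsto_nat_atTop_of_nonneg hf).1 h
  have hstep (n : ℕ) : ∃ m, n < m ∧ 1 ≤ ∑ i ∈ Finset.Ico n m, f i := by
    obtain ⟨m, hm, hnm⟩ := ((hT.eventually_ge_atTop (∑ i ∈ Finset.range n, f i + 1)).and
      (eventually_gt_atTop n)).exists
    refine ⟨m, hnm, ?_⟩
    rw [Finset.sum_Ico_eq_sub _ hnm.le]
    linarith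
  choose g hg hsum using hstep
  refine ⟨fun j => g^[j] 0, strictMono_nat_of_lt_succ fun j => ?_, fun j => ?_⟩
  · rw [Function.iterate_succ_apply']
    exact hg _
  · simp only [Function.iterate_succ_apply']
    exact hsum _

theorem iUnion_block_notMem_recipIdeal {X : Set ℕ} {a : ℕ → ℕ} (ha : StrictMono a)
    (hsum : ∀ j, 1 ≤ ∑ i ∈ Finset.Ico (a j) (a (j + 1)), X.indicator (fun x : ℕ => (1 : ℝ) / x) i)
    {K : Set ℕ} (hK : K.Infinite) : (⋃ k ∈ K, block X a k) ∉ recipIdeal := by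
  intro h
  obtain ⟨s, hs⟩ := summable_iff_vanishing_norm.1 h 1 one_pos
  obtain ⟨k, hkK, hk⟩ := hK.exists_gt (s.sup id)
  have hdisj : Disjoint (Finset.Ico (a k) (a (k + 1))) s := by
    refine Finset.disjoint_left.2 fun x hx hxs => ?_
    have h1 : x ≤ s.sup id := Finset.le_sup (f := id) hxs
    have h2 := (Finset.mem_Ico.1 hx).1
    have h3 := ha.le_apply (x := k)
    omega
  have heq : ∑ i ∈ Finset.Ico (a k) (a (k + 1)),
      (⋃ k ∈ K, block X a k).indicator (fun x : ℕ => (1 : ℝ) / x) i =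
      ∑ i ∈ Finset.Ico (a k) (a (k + 1)), X.indicator (fun x : ℕ => (1 : ℝ) / x) i := by
    refine Finset.sum_congr rfl fun i hi => ?_
    by_cases hiX : i ∈ X
    · rw [Set.indicator_of_mem hiX, Set.indicator_of_mem]
      exact Set.mem_biUnion hkK ⟨hiX, Finset.mem_Ico.1 hi⟩
    · rw [Set.indicator_of_notMem hiX, Set.indicator_of_notMem]
      exact fun hmem => hiX (Set.iUnion₂_subset (fun _ _ => Set.inter_subset_left) hmem)
  have hlt := hs _ hdisj
  rw [heq] at hlt
  exact absurd ((hsum k).trans (Real.le_norm_self _)) hlt.not_ge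

theorem nonempty_block {X : Set ℕ} {a : ℕ → ℕ} {j : ℕ}
    (hsum : 1 ≤ ∑ i ∈ Finset.Ico (a j) (a (j + 1)), X.indicator (fun x : ℕ => (1 : ℝ) / x) i) :
    (block X a j).Nonempty := by
  obtain ⟨i, hi, hne⟩ := Finset.exists_ne_zero_of_sum_ne_zero (one_pos.trans_le hsum).ne'
  exact ⟨i, Set.mem_of_indicator_ne_zero hne, Finset.mem_Ico.1 hi⟩

/-- The much larger inclusion `𝐫 ⋐ 𝐝`. -/
theorem recip_muchLarger_dens : MuchLarger recipIdeal densIdeal := by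
  refine ⟨⟨recipIdeal_subset_densIdeal, fun h =>
    not_summable_one_div_on_primes (h setOf_prime_mem_densIdeal)⟩, ?_⟩
  obtain ⟨a, ha, hsum⟩ := exists_strictMono_one_le_sum_Ico
    (fun n => Set.indicator_nonneg (fun _ _ => by positivity) n) not_summable_one_div_on_primes
  exact ⟨block {p | p.Prime} a, fun n => mem_recipIdeal_of_finite (finite_block _ a n),
    fun n => nonempty_block (hsum n), fun m n => disjoint_block _ ha.monotone,
    fun K hK => ⟨densIdeal_of_subset (Set.iUnion₂_subset fun _ _ => Set.inter_subset_left)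
      setOf_prime_mem_densIdeal, iUnion_block_notMem_recipIdeal ha hsum hK⟩⟩
end

section
/- The much larger inclusion 𝐭 ⋐ 𝐛 holds: 𝐭 ⊊ 𝐛 and there exists a countable collection {D_j}_{j∈ℕ} ⊆ 𝐭 of nonempty pairwise disjoint subsets of ℕ such that for every infinite subset K ⊆ ℕ, the union ⋃_{k∈K} D_k belongs to 𝐛 \ 𝐭. -/
open Filter

/-- A set whose interval counts are bounded by `C + ε n` for every `ε > 0` has Banach density
zero. -/
lemma mem_banachIdeal_of_forall_le {X : Set ℕ}
    (h : ∀ ε : ℝ, 0 < ε → ∃ C : ℝ, ∀ k n : ℕ, (cntI X k n : ℝ) ≤ C + ε * n) :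
    X ∈ banachIdeal := by
  change Tendsto (fun n : ℕ => (maxCnt X n : ℝ) / n) atTop (nhds 0)
  rw [Metric.tendsto_atTop]
  intro ε hε
  obtain ⟨C, hC⟩ := h (ε / 2) (by positivity)
  obtain ⟨N, hN⟩ := exists_nat_gt (C / (ε / 2))
  refine ⟨N + 1, fun n hn => ?_⟩
  have hn' : (N : ℝ) + 1 ≤ n := by exact_mod_cast hn
  have hn0 : (0 : ℝ) < n := by have := N.cast_nonneg (α := ℝ); linarith
  have h0 : 0 ≤ C + ε / 2 * n := le_trans (Nat.cast_nonneg _) (hC 0 n)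
  have hmax : (maxCnt X n : ℝ) ≤ C + ε / 2 * n := by
    refine le_trans (Nat.cast_le.mpr (csSup_le ⟨_, 0, rfl⟩ ?_)) (Nat.floor_le h0)
    rintro m ⟨k, rfl⟩
    exact Nat.le_floor (hC k n)
  rw [div_lt_iff₀ (by positivity)] at hN
  rw [Real.dist_0_eq_abs, abs_of_nonneg (by positivity), div_lt_iff₀ hn0]
  nlinarith

lemma cntI_le_add_of_subset_union {X F A : Set ℕ} (hF : F.Finite) (h : X ⊆ F ∪ A) (k n : ℕ) :
    cntI X k n ≤ F.ncard + cntI A k n := by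
  have hfin : (A ∩ Set.Icc (k + 1) (k + n)).Finite := (Set.finite_Icc _ _).inter_of_right _
  refine le_trans (Set.ncard_le_ncard ?_ (hF.union hfin)) (Set.ncard_union_le _ _)
  rintro x ⟨hx, hxI⟩
  exact (h hx).imp id fun hA => ⟨hA, hxI⟩

/-- A map that is injective on `s` and takes values in `range (n + 1) ×ˢ T` bounds `s`. -/
lemma ncard_le_mul_of_injOn {s T : Set ℕ} (hT : T.Finite) (n : ℕ) (f : ℕ → ℕ × ℕ)
    (hf : ∀ x ∈ s, (f x).1 ≤ n ∧ (f x).2 ∈ T) (hinj : Set.InjOn f s) :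
    s.ncard ≤ (n + 1) * T.ncard := by
  have := Set.ncard_le_ncard_of_injOn (t := Set.Iic n ×ˢ T) f (fun x hx => hf x hx) hinj
    ((Set.finite_Iic n).prod hT)
  rwa [Set.ncard_prod, Set.ncard_eq_toFinset_card' (Set.Iic n), Set.toFinset_Iic,
    Nat.card_Iic] at this

lemma eq_of_div_eq_of_modEq {r u v : ℕ} (h : u / r = v / r) (hm : u ≡ v [MOD r]) : u = v := by
  rw [← Nat.div_add_mod u r, ← Nat.div_add_mod v r, h, hm]

lemma cntI_tiling_le {r b : ℕ} {T : Set ℕ} (hT : T ⊆ Set.Iio r) (k n : ℕ) :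
    cntI (tiling r b T) k n ≤ (n / r + 1) * T.ncard := by
  refine ncard_le_mul_of_injOn ((Set.finite_Iio r).subset hT) _
    (fun x => ((x - (k + 1)) / r, (x - b) % r)) ?_ ?_
  · rintro x ⟨⟨t, ht, j, rfl⟩, hx⟩
    obtain ⟨h1, h2⟩ := hx
    refine ⟨Nat.div_le_div_right (by omega), ?_⟩
    have : t + j * r + b - b = t + j * r := by omega
    simp only [this, Nat.add_mul_mod_self_right, Nat.mod_eq_of_lt (hT ht), ht]
  · rintro x ⟨⟨t, ht, j, rfl⟩, hx⟩ y ⟨⟨t', ht', j', rfl⟩, hy⟩ hxy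
    obtain ⟨h1, h2⟩ := Prod.ext_iff.mp hxy
    simp only [Nat.add_sub_cancel] at h2
    have h3 : t + j * r + b ≡ t' + j' * r + b [MOD r] := Nat.ModEq.add_right b h2
    have h4 := eq_of_div_eq_of_modEq (r := r) h1 (by
      refine Nat.ModEq.add_right_cancel' (k + 1) ?_
      rwa [Nat.sub_add_cancel hx.1, Nat.sub_add_cancel hy.1])
    have := hx.1
    have := hy.1
    omega

lemma mul_ncard_le_cnt_tiling {r b : ℕ} (hb : 0 < b) {T : Set ℕ} (hT : T ⊆ Set.Iio r)
    {q n : ℕ} (hq : q * r + b ≤ n) : q * T.ncard ≤ cnt (tiling r b T) n := by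
  have key : (Set.Iio q ×ˢ T).ncard ≤ (tiling r b T ∩ Set.Icc 1 n).ncard := by
    refine Set.ncard_le_ncard_of_injOn (fun p => p.2 + p.1 * r + b) ?_ ?_
      ((Set.finite_Icc _ _).inter_of_right _)
    · rintro ⟨j, t⟩ ⟨hj, ht⟩
      refine ⟨⟨t, ht, j, rfl⟩, ?_, ?_⟩
      · change 1 ≤ t + j * r + b
        omega
      · have h1 : t < r := hT ht
        have h2 : j + 1 ≤ q := hj
        have h3 := Nat.mul_le_mul_right r h2
        change t + j * r + b ≤ n
        rw [add_mul] at h3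
        omega
    · rintro ⟨j, t⟩ ⟨hj, ht⟩ ⟨j', t'⟩ ⟨hj', ht'⟩ h
      have h1 : t < r := hT ht
      have h2 : t' < r := hT ht'
      have h3 : t + j * r = t' + j' * r := by simpa using h
      have h4 : t = t' := by
        have := congrArg (· % r) h3
        simpa [Nat.mod_eq_of_lt h1, Nat.mod_eq_of_lt h2] using this
      subst h4
      have h5 : j = j' := Nat.eq_of_mul_eq_mul_right (by omega) (Nat.add_left_cancel h3)
      rw [h5]
  rwa [Set.ncard_prod, Set.ncard_eq_toFinset_card' (Set.Iio q), Set.toFinset_Iio,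
    Nat.card_Iio] at key

lemma ncard_div_le_of_hasDensity_tiling {r b : ℕ} (hr : 0 < r) (hb : 0 < b) {T : Set ℕ}
    (hT : T ⊆ Set.Iio r) {δ : ℝ} (h : HasDensity (tiling r b T) δ) :
    (T.ncard : ℝ) / r ≤ δ := by
  have hr' : (0 : ℝ) < r := by exact_mod_cast hr
  have hlim : Tendsto (fun n : ℕ => (T.ncard : ℝ) / r - (T.ncard * (b + r) / r) / n)
      atTop (nhds ((T.ncard : ℝ) / r - 0)) :=
    tendsto_const_nhds.sub (tendsto_const_div_atTop_nhds_zero_nat _)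
  rw [sub_zero] at hlim
  refine le_of_tendsto_of_tendsto hlim h ?_
  filter_upwards [eventually_ge_atTop b] with n hn
  have hn' : (0 : ℝ) < n := by exact_mod_cast hb.trans_le hn
  have hdiv := Nat.div_add_mod (n - b) r
  have hmod := Nat.mod_lt (n - b) hr
  have h1 := mul_ncard_le_cnt_tiling hb hT (q := (n - b) / r) (n := n) (by
    rw [mul_comm]; omega)
  have h2 : (n : ℝ) ≤ r * ((n - b) / r : ℕ) + r + b := by
    exact_mod_cast (by omega : n ≤ r * ((n - b) / r) + r + b)
  have h3 : (((n - b) / r : ℕ) : ℝ) * T.ncard ≤ cnt (tiling r b T) n := by exact_mod_cast h1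
  rw [le_div_iff₀ hn', sub_mul, div_mul_cancel₀ _ hn'.ne']
  refine le_trans ?_ h3
  rw [div_mul_eq_mul_div, ← sub_div, div_le_iff₀ hr']
  nlinarith [mul_le_mul_of_nonneg_left h2 (Nat.cast_nonneg (α := ℝ) T.ncard)]

lemma tileDens_set_nonempty (X : Set ℕ) :
    {δ : ℝ | ∃ A ∈ calT, ModF X A ∧ HasDensity A δ}.Nonempty := by
  refine ⟨1, _, ⟨1, 1, one_pos, one_pos, Set.Iio 1, subset_rfl, rfl⟩, ?_, ?_⟩
  · refine (Set.finite_singleton 0).subset fun x hx => ?_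
    by_contra h0
    exact hx.2 ⟨0, by simp, x - 1, by rw [Set.mem_singleton_iff] at h0; omega⟩
  · refine tendsto_const_nhds.congr' ?_
    filter_upwards [eventually_gt_atTop 0] with n hn
    have h : tiling 1 1 (Set.Iio 1) ∩ Set.Icc 1 n = Set.Icc 1 n := by
      refine Set.inter_eq_right.mpr fun x hx => ⟨0, by simp, x - 1, ?_⟩
      have := hx.1
      omega
    have hn' : (n : ℝ) ≠ 0 := by positivity
    rw [cnt, h]
    simp [hn']

lemma hasDensity_nonneg {A : Set ℕ} {δ : ℝ} (h : HasDensity A δ) : 0 ≤ δ :=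
  ge_of_tendsto' h fun _ => by positivity

lemma finite_mem_tileIdeal {X : Set ℕ} (hX : X.Finite) : X ∈ tileIdeal := by
  refine le_antisymm (csInf_le ⟨0, ?_⟩ ⟨_, ⟨1, 1, one_pos, one_pos, ∅, by simp, rfl⟩,
    hX.subset Set.sdiff_subset, ?_⟩) (Real.sInf_nonneg ?_)
  · rintro δ ⟨A, -, -, h⟩
    exact hasDensity_nonneg h
  · simp [HasDensity, tiling, cnt]
  · rintro δ ⟨A, -, -, h⟩
    exact hasDensity_nonneg h

lemma tileIdeal_subset_banachIdeal : tileIdeal ⊆ banachIdeal := by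
  intro X hX
  refine mem_banachIdeal_of_forall_le fun ε hε => ?_
  have hlt : tileDens X < ε := by
    rw [show tileDens X = 0 from hX]
    exact hε
  obtain ⟨δ, ⟨A, ⟨r, b, hr, hb, T, hT, rfl⟩, hmod, hδ⟩, hδε⟩ :=
    exists_lt_of_csInf_lt (tileDens_set_nonempty X) hlt
  have hr' : (0 : ℝ) < r := by exact_mod_cast hr
  have hTr := (ncard_div_le_of_hasDensity_tiling hr hb hT hδ).trans hδε.le
  refine ⟨(X \ tiling r b T).ncard + T.ncard, fun k n => ?_⟩
  have h1 := cntI_le_add_of_subset_union hmod (A := tiling r b T) (X := X)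
    (by rw [Set.sdiff_union_self]; exact Set.subset_union_left) k n
  have h2 := h1.trans (Nat.add_le_add_left (cntI_tiling_le hT k n) _)
  have h3 : (cntI X k n : ℝ) ≤
      (X \ tiling r b T).ncard + ((n / r : ℕ) + 1) * T.ncard := by exact_mod_cast h2
  have h4 : ((n / r : ℕ) : ℝ) * T.ncard ≤ ε * n := calc
    ((n / r : ℕ) : ℝ) * T.ncard ≤ (n : ℝ) / r * T.ncard := by gcongr; exact Nat.cast_div_le
    _ = T.ncard / r * n := by ring
    _ ≤ ε * n := by gcongr
  linarith

/-- A set meeting every residue class of every modulus in arbitrarily large elements does not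
have tile density zero. -/
lemma not_mem_tileIdeal_of_forall_modEq {X : Set ℕ}
    (h : ∀ r s N : ℕ, 0 < r → ∃ x ∈ X, N ≤ x ∧ x ≡ s [MOD r]) : X ∉ tileIdeal := by
  intro hX
  have h1 : 1 ≤ tileDens X := by
    refine le_csInf (tileDens_set_nonempty X) ?_
    rintro δ ⟨A, ⟨r, b, hr, hb, T, hT, rfl⟩, hmod, hδ⟩
    have hT' : T = Set.Iio r := by
      refine hT.antisymm fun t ht => ?_
      obtain ⟨N, hN⟩ := hmod.bddAbove
      obtain ⟨x, hx, hNx, hxt⟩ := h r (t + b) (N + 1) hr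
      have hxA : x ∈ tiling r b T := by
        by_contra hxA
        have := hN ⟨hx, hxA⟩
        omega
      obtain ⟨t', ht', j, rfl⟩ := hxA
      have h2 : t' + j * r ≡ t [MOD r] := Nat.ModEq.add_right_cancel' b hxt
      have h3 : t' < r := hT ht'
      have h4 : t < r := ht
      rw [Nat.ModEq, Nat.add_mul_mod_self_right, Nat.mod_eq_of_lt h3, Nat.mod_eq_of_lt h4] at h2
      exact h2 ▸ ht'
    have h5 := ncard_div_le_of_hasDensity_tiling hr hb hT hδ
    have hr' : (r : ℝ) ≠ 0 := by positivity
    have h6 : T.ncard = r := by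
      rw [hT', Set.ncard_eq_toFinset_card', Set.toFinset_Iio, Nat.card_Iio]
    rwa [h6, div_self hr'] at h5
  rw [show tileDens X = 0 from hX] at h1
  linarith

/-- A sequence whose gaps tend to infinity and which, along `Nat.sqrt m = j`, runs through all
residue classes modulo every `r ≤ j`. -/
def factorialShift (m : ℕ) : ℕ := (m + 2).factorial + (m - m.sqrt ^ 2)

lemma factorialShift_add_lt_succ (m : ℕ) : factorialShift m + m < factorialShift (m + 1) := by
  have h1 : (m + 1 + 2).factorial = (m + 3) * (m + 2).factorial := Nat.factorial_succ (m + 2)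
  have h2 : m + 2 ≤ (m + 2).factorial := Nat.self_le_factorial _
  have h3 : m - m.sqrt ^ 2 ≤ m := Nat.sub_le _ _
  unfold factorialShift
  rw [h1]
  nlinarith

lemma factorialShift_strictMono : StrictMono factorialShift :=
  strictMono_nat_of_lt_succ fun m => by have := factorialShift_add_lt_succ m; omega

lemma factorialShift_add_lt {m m' : ℕ} (h : m < m') :
    factorialShift m + m < factorialShift m' :=
  (factorialShift_add_lt_succ m).trans_le (factorialShift_strictMono.monotone h)

lemma cntI_le_of_subset_range_factorialShift {X : Set ℕ} (hX : X ⊆ Set.range factorialShift)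
    {L : ℕ} (hL : 0 < L) (k n : ℕ) : cntI X k n ≤ L + (n / L + 1) := by
  have h1 := cntI_le_add_of_subset_union (X := X) (F := factorialShift '' Set.Iio L)
    (A := factorialShift '' Set.Ici L) ((Set.finite_Iio L).image _)
    (by rwa [← Set.image_union, Set.Iio_union_Ici, Set.image_univ]) k n
  have h2 : (factorialShift '' Set.Iio L).ncard = L := by
    rw [Set.ncard_image_of_injective _ factorialShift_strictMono.injective,
      Set.ncard_eq_toFinset_card', Set.toFinset_Iio, Nat.card_Iio]
  have h3 : cntI (factorialShift '' Set.Ici L) k n ≤ (n / L + 1) * ({0} : Set ℕ).ncard := by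
    refine ncard_le_mul_of_injOn (Set.finite_singleton 0) _ (fun x => ((x - (k + 1)) / L, 0)) ?_ ?_
    · rintro x ⟨-, hx⟩
      have := hx.2
      exact ⟨Nat.div_le_div_right (by omega), rfl⟩
    · have key : ∀ m m', L ≤ m → m < m' → k + 1 ≤ factorialShift m →
          (factorialShift m - (k + 1)) / L < (factorialShift m' - (k + 1)) / L := by
        intro m m' hm hmm hk
        have := factorialShift_add_lt hmm
        calc (factorialShift m - (k + 1)) / L
            < (factorialShift m - (k + 1)) / L + 1 := Nat.lt_succ_self _
          _ = (factorialShift m - (k + 1) + L) / L := (Nat.add_div_right _ hL).symm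
          _ ≤ _ := Nat.div_le_div_right (by omega)
      rintro _ ⟨⟨m, hm, rfl⟩, hx⟩ _ ⟨⟨m', hm', rfl⟩, hy⟩ hxy
      have hq := congrArg Prod.fst hxy
      rcases lt_trichotomy m m' with hlt | rfl | hlt
      · exact absurd hq (key m m' hm hlt hx.1).ne
      · rfl
      · exact absurd hq (key m' m hm' hlt hy.1).ne'
  rw [Set.ncard_singleton, mul_one] at h3
  omega

lemma mem_banachIdeal_of_subset_range_factorialShift {X : Set ℕ}
    (hX : X ⊆ Set.range factorialShift) : X ∈ banachIdeal := by
  refine mem_banachIdeal_of_forall_le fun ε hε => ?_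
  obtain ⟨L, hL⟩ := exists_nat_one_div_lt hε
  refine ⟨L + 2, fun k n => ?_⟩
  have h1 : (cntI X k n : ℝ) ≤ (L + 1 : ℕ) + ((n / (L + 1) : ℕ) + 1) := by
    exact_mod_cast cntI_le_of_subset_range_factorialShift hX L.succ_pos k n
  have h2 : ((n / (L + 1) : ℕ) : ℝ) ≤ ε * n := calc
    ((n / (L + 1) : ℕ) : ℝ) ≤ (n : ℝ) / (L + 1 : ℕ) := Nat.cast_div_le
    _ = 1 / ((L : ℝ) + 1) * n := by push_cast; ring
    _ ≤ ε * n := by gcongr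
  push_cast at h1
  linarith

/-- The values of `factorialShift` at the indices `m` with `Nat.sqrt m = j`. -/
def factorialBlock (j : ℕ) : Set ℕ := factorialShift '' {m | m.sqrt = j}

lemma factorialBlock_finite (j : ℕ) : (factorialBlock j).Finite := by
  refine ((Set.finite_Iio ((j + 1) * (j + 1))).subset ?_).image _
  rintro m rfl
  exact Nat.lt_succ_sqrt m

lemma exists_mem_factorialBlock_modEq {j r s : ℕ} (hr : 0 < r) (hrj : r ≤ j) :
    ∃ x ∈ factorialBlock j, j ≤ x ∧ x ≡ s [MOD r] := by
  have hs := Nat.mod_lt s hr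
  have hsqrt : (j * j + s % r).sqrt = j := Nat.sqrt_add_eq j (by omega)
  refine ⟨_, ⟨j * j + s % r, hsqrt, rfl⟩, ?_, ?_⟩
  · have := Nat.self_le_factorial (j * j + s % r + 2)
    have := Nat.le_mul_self j
    unfold factorialShift
    omega
  · have hsub : j * j + s % r - (j * j + s % r).sqrt ^ 2 = s % r := by
      rw [hsqrt, sq, Nat.add_sub_cancel_left]
    have hdvd : r ∣ (j * j + s % r + 2).factorial :=
      Nat.dvd_factorial hr (by have := Nat.le_mul_self j; omega)
    rw [factorialShift, hsub]
    simpa using ((Nat.modEq_zero_iff_dvd.mpr hdvd).add (Nat.mod_modEq s r))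

lemma biUnion_factorialBlock_mem_banachIdeal (K : Set ℕ) :
    (⋃ k ∈ K, factorialBlock k) ∈ banachIdeal :=
  mem_banachIdeal_of_subset_range_factorialShift
    (Set.iUnion₂_subset fun _ _ => Set.image_subset_range _ _)

lemma biUnion_factorialBlock_not_mem_tileIdeal {K : Set ℕ} (hK : K.Infinite) :
    (⋃ k ∈ K, factorialBlock k) ∉ tileIdeal := by
  refine not_mem_tileIdeal_of_forall_modEq fun r s N hr => ?_
  obtain ⟨k, hk, hlt⟩ := hK.exists_gt (max r N)
  obtain ⟨x, hx, hkx, hxs⟩ := exists_mem_factorialBlock_modEq (s := s) hr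
    ((le_max_left r N).trans hlt.le)
  exact ⟨x, Set.mem_biUnion hk hx, ((le_max_right r N).trans hlt.le).trans hkx, hxs⟩

/-- The much larger inclusion `𝐭 ⋐ 𝐛`. -/
theorem tile_muchLarger_banach : MuchLarger tileIdeal banachIdeal := by
  refine ⟨⟨tileIdeal_subset_banachIdeal, fun h => ?_⟩, factorialBlock,
    fun j => finite_mem_tileIdeal (factorialBlock_finite j),
    fun j => ⟨_, j * j, Nat.sqrt_eq j, rfl⟩, fun m n hmn => ?_,
    fun K hK => ⟨biUnion_factorialBlock_mem_banachIdeal K,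
      biUnion_factorialBlock_not_mem_tileIdeal hK⟩⟩
  · exact biUnion_factorialBlock_not_mem_tileIdeal Set.infinite_univ
      (h (biUnion_factorialBlock_mem_banachIdeal Set.univ))
  · refine (Set.disjoint_image_iff factorialShift_strictMono.injective).mpr ?_
    exact Set.disjoint_left.mpr fun x hx hx' => hmn (hx.symm.trans hx')
end
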